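/- arXiv:2202.04792 — 3 statements merged into one kernel-verified Lean document; each statement's English description precedes it below -/
import Mathlib

section
/- Let R be a commutative Noetherian local ring and M a finitely generated R-module such that M is isomorphic to its second syzygy Ω²M and M is locally free on the punctured spectrum of R. Then for every finitely generated R-module N and every i ≥ 1, Tor_i^R(M,N) ≅ Tor_{i+2}^R(M,N) and Tor_i^R(M,N) has finite length. -/
open CategoryTheory IsLocalRing

noncomputable section

variable (R : Type) [CommRing R]

/-- `Tor_i^R(M,N)` as a type. -/
abbrev TorM (i : ℕ) (M N : Type) [AddCommGroup M] [Module R M]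
    [AddCommGroup N] [Module R N] : Type :=
  ((Tor (ModuleCat R) i).obj (ModuleCat.of R M)).obj (ModuleCat.of R N)

/-- `Ext^i_R(M,N)` as a type. -/
abbrev ExtM (i : ℕ) (M N : Type) [AddCommGroup M] [Module R M]
    [AddCommGroup N] [Module R N] : Type :=
  ((Ext R (ModuleCat R) i).obj (Opposite.op (ModuleCat.of R M))).obj (ModuleCat.of R N)

/-- `M` is isomorphic to its `q`-th syzygy `Ω^q M` in a minimal free resolution. -/
def IsPeriodicSyzygy [IsLocalRing R] (M : Type) [AddCommGroup M] [Module R M]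
    (q : ℕ) : Prop :=
  ∃ (n : ℕ → ℕ) (d : ∀ i : ℕ, ((Fin (n (i + 1)) → R) →ₗ[R] (Fin (n i) → R)))
    (g : (Fin (n 0) → R) →ₗ[R] M),
    Function.Surjective g ∧
    LinearMap.ker g = LinearMap.range (d 0) ∧
    (∀ i, LinearMap.ker (d i) = LinearMap.range (d (i + 1))) ∧
    LinearMap.ker g ≤ (maximalIdeal R) • (⊤ : Submodule R (Fin (n 0) → R)) ∧
    (∀ i, LinearMap.range (d i) ≤ (maximalIdeal R) • (⊤ : Submodule R (Fin (n i) → R))) ∧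
    Nonempty (M ≃ₗ[R] LinearMap.range (d (q - 1)))

/-- `M` is locally free on the punctured spectrum of the local ring `R`. -/
def LocFreePunctured [IsLocalRing R] (M : Type) [AddCommGroup M] [Module R M] : Prop :=
  ∀ (p : Ideal R) (_ : p.IsPrime), p ≠ maximalIdeal R →
    Module.Free (Localization.AtPrime p) (LocalizedModule p.primeCompl M)

/-- index type parametrizing all finitely generated `R`-modules (via presentations) -/
abbrev FGIdx := Σ n : ℕ, Submodule R (Fin n → R)

abbrev idxMod (x : FGIdx R) : Type := (Fin x.1 → R) ⧸ x.2

/-- relations (from short exact sequences) defining the Grothendieck group, ℚ-coefficients -/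
def gRelQ : Set (FGIdx R →₀ ℚ) :=
  { v | ∃ (x y z : FGIdx R) (f : idxMod R x →ₗ[R] idxMod R y)
      (g : idxMod R y →ₗ[R] idxMod R z),
      Function.Injective f ∧ Function.Surjective g ∧
      LinearMap.range f = LinearMap.ker g ∧
      v = Finsupp.single y 1 - Finsupp.single x 1 - Finsupp.single z 1 }

/-- relations defining the reduced Grothendieck group with ℚ-coefficients:
SES relations together with the class of `R` itself. -/
def gRelQbar : Set (FGIdx R →₀ ℚ) :=
  gRelQ R ∪ { v | ∃ x : FGIdx R, Nonempty (idxMod R x ≃ₗ[R] R) ∧ v = Finsupp.single x 1 }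

/-- The reduced Grothendieck group with rational coefficients `Ḡ(R)_ℚ`. -/
abbrev GbarQ : Type := (FGIdx R →₀ ℚ) ⧸ Submodule.span ℚ (gRelQbar R)

/-- `[N] = 0` in the reduced Grothendieck group with rational coefficients. -/
def ClassZeroQ (N : Type) [AddCommGroup N] [Module R N] : Prop :=
  ∀ x : FGIdx R, Nonempty (idxMod R x ≃ₗ[R] N) →
    (Submodule.Quotient.mk (p := Submodule.span ℚ (gRelQbar R))
      (Finsupp.single x 1) : GbarQ R) = 0

/-- relations (from short exact sequences) defining the Grothendieck group `G(R)` -/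
def gRelZ : Set (FGIdx R →₀ ℤ) :=
  { v | ∃ (x y z : FGIdx R) (f : idxMod R x →ₗ[R] idxMod R y)
      (g : idxMod R y →ₗ[R] idxMod R z),
      Function.Injective f ∧ Function.Surjective g ∧
      LinearMap.range f = LinearMap.ker g ∧
      v = Finsupp.single y 1 - Finsupp.single x 1 - Finsupp.single z 1 }

/-- The Grothendieck group `G(R)` of finitely generated `R`-modules. -/
abbrev GZ : Type := (FGIdx R →₀ ℤ) ⧸ Submodule.span ℤ (gRelZ R)

open Classical in
noncomputable def gcl (N : Type) [AddCommGroup N] [Module R N] : GZ R :=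
  if h : ∃ x : FGIdx R, Nonempty (idxMod R x ≃ₗ[R] N) then
    Submodule.Quotient.mk (p := Submodule.span ℤ (gRelZ R)) (Finsupp.single h.choose 1)
  else 0

/-- `[N] = 0` in the Grothendieck group `G(R)`. -/
def ClassZeroZ (N : Type) [AddCommGroup N] [Module R N] : Prop :=
  ∀ x : FGIdx R, Nonempty (idxMod R x ≃ₗ[R] N) →
    (Submodule.Quotient.mk (p := Submodule.span ℤ (gRelZ R))
      (Finsupp.single x 1) : GZ R) = 0

/-- the residue field of a local ring, as an `R`-module -/
abbrev resF [IsLocalRing R] : Type := R ⧸ (maximalIdeal R)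

/-- `R` is a Gorenstein local ring of Krull dimension `d`
(characterized by `Ext^i_R(k,R) = 0` for `i ≠ d` and `Ext^d_R(k,R) ≅ k`). -/
def IsGorensteinOfDim [IsLocalRing R] (d : ℕ) : Prop :=
  ringKrullDim R = d ∧
  (∀ i : ℕ, i ≠ d → Subsingleton (ExtM R i (resF R) R)) ∧
  Nonempty ((ExtM R d (resF R) R) ≃ₗ[R] resF R)

/-- `R` is a Cohen-Macaulay local ring of Krull dimension `d` (depth R = dim R = d,
depth computed via `Ext^i(k,R)`). -/
def IsCMOfDim [IsLocalRing R] (d : ℕ) : Prop :=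
  ringKrullDim R = d ∧
  (∀ i : ℕ, i < d → Subsingleton (ExtM R i (resF R) R)) ∧
  Nontrivial (ExtM R d (resF R) R)

/-- `ω` is a canonical module of the `d`-dimensional Cohen-Macaulay local ring `R`. -/
def IsCanonicalModule [IsLocalRing R] (d : ℕ) (ω : Type) [AddCommGroup ω] [Module R ω] : Prop :=
  Module.Finite R ω ∧
  (∀ i : ℕ, i ≠ d → Subsingleton (ExtM R i (resF R) ω)) ∧
  Nonempty ((ExtM R d (resF R) ω) ≃ₗ[R] resF R)

/-- `M` has depth `d` and is maximal Cohen-Macaulay over the `d`-dimensional local ring `R`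
(depth computed via `Ext^i(k,M)`). -/
def IsMCM [IsLocalRing R] (d : ℕ) (M : Type) [AddCommGroup M] [Module R M] : Prop :=
  (∀ i : ℕ, i < d → Subsingleton (ExtM R i (resF R) M)) ∧
  Nontrivial (ExtM R d (resF R) M)

/-- `M` has a free resolution of length at most `k` (so `pd_R M ≤ k`). -/
def PdLE (M : Type) [AddCommGroup M] [Module R M] (k : ℕ) : Prop :=
  ∃ (n : ℕ → ℕ) (d : ∀ i : ℕ, ((Fin (n (i + 1)) → R) →ₗ[R] (Fin (n i) → R)))
    (g : (Fin (n 0) → R) →ₗ[R] M),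
    Function.Surjective g ∧
    LinearMap.ker g = LinearMap.range (d 0) ∧
    (∀ i, LinearMap.ker (d i) = LinearMap.range (d (i + 1))) ∧
    (∀ i, k < i → n i = 0)

/-- `G` is a totally reflexive `R`-module. -/
def IsTotallyReflexive (G : Type) [AddCommGroup G] [Module R G] : Prop :=
  Module.Finite R G ∧
  Function.Bijective (Module.Dual.eval R G) ∧
  (∀ i : ℕ, 1 ≤ i → Subsingleton (ExtM R i G R)) ∧
  (∀ i : ℕ, 1 ≤ i → Subsingleton (ExtM R i (Module.Dual R G) R))

/-- `M` has a resolution by totally reflexive modules of length at most `g`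
(so `Gdim_R M ≤ g`). -/
def GdimLE (M : Type) [AddCommGroup M] [Module R M] (g : ℕ) : Prop :=
  ∃ (G : ℕ → ModuleCat R) (d : ∀ i : ℕ, ((G (i + 1) : Type) →ₗ[R] (G i : Type)))
    (ε : (G 0 : Type) →ₗ[R] M),
    (∀ i, IsTotallyReflexive R (G i)) ∧
    Function.Surjective ε ∧
    LinearMap.ker ε = LinearMap.range (d 0) ∧
    (∀ i, LinearMap.ker (d i) = LinearMap.range (d (i + 1))) ∧
    (∀ i, g < i → Subsingleton (G i : Type))

open Classical in
noncomputable def mlen (M : Type) [AddCommGroup M] [Module R M] : ℕ :=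
  if h : ∃ s : CompositionSeries (Submodule R M), s.head = ⊥ ∧ s.last = ⊤ then
    h.choose.length
  else 0

/-- Hochster's theta invariant `θ(M,N)` computed using `Tor_{2n}` and `Tor_{2n-1}`. -/
noncomputable def theta (M N : Type) [AddCommGroup M] [Module R M]
    [AddCommGroup N] [Module R N] (n : ℕ) : ℤ :=
  (mlen R (TorM R (2 * n) M N) : ℤ) - (mlen R (TorM R (2 * n - 1) M N) : ℤ)

/-- `C` has rank `r`: localization at every associated prime of `R` is free of rank `r`. -/
def HasRankN (C : Type) [AddCommGroup C] [Module R C] (r : ℕ) : Prop :=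
  ∀ (p : Ideal R) (_ : p.IsPrime), p ∈ associatedPrimes R R →
    Nonempty ((LocalizedModule p.primeCompl C) ≃ₗ[Localization.AtPrime p]
      (Fin r → Localization.AtPrime p))

end

noncomputable section

open MonoidalCategory in
/-- The complex `A ⊗ P`. -/
def tcx {R : Type} [CommRing R] (P : ChainComplex (ModuleCat.{0} R) ℕ) (A : ModuleCat.{0} R) :
    ChainComplex (ModuleCat.{0} R) ℕ :=
  (((tensoringLeft (ModuleCat.{0} R)).obj A).mapHomologicalComplex _).obj P

open MonoidalCategory in
/-- Functoriality of `A ⊗ P` in `A`. -/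
def tcxMap {R : Type} [CommRing R] (P : ChainComplex (ModuleCat.{0} R) ℕ) {A B : ModuleCat.{0} R}
    (f : A ⟶ B) : tcx P A ⟶ tcx P B :=
  (NatTrans.mapHomologicalComplex ((tensoringLeft (ModuleCat.{0} R)).map f) _).app P

lemma tcxMap_comp {R : Type} [CommRing R] (P : ChainComplex (ModuleCat.{0} R) ℕ)
    {A B C : ModuleCat.{0} R} (f : A ⟶ B) (g : B ⟶ C) :
    tcxMap P (f ≫ g) = tcxMap P f ≫ tcxMap P g := by
  simp only [tcxMap, Functor.map_comp, NatTrans.mapHomologicalComplex_comp, NatTrans.comp_app]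
  rfl

lemma tcxMap_f {R : Type} [CommRing R] (P : ChainComplex (ModuleCat.{0} R) ℕ) 
    {A B : ModuleCat.{0} R} (f : A ⟶ B) (i : ℕ) :
    (tcxMap P f).f i = MonoidalCategoryStruct.whiskerRight f (P.X i) := rfl

lemma tcxMap_smul {R : Type} [CommRing R] (P : ChainComplex (ModuleCat.{0} R) ℕ)
    (A : ModuleCat.{0} R) (s : R) :
    tcxMap P (s • 𝟙 A) = s • 𝟙 (tcx P A) := by
  ext i : 1
  rw [tcxMap_f, MonoidalLinear.smul_whiskerRight, MonoidalCategory.id_whiskerRight]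
  rfl

lemma tcx_shortExact {R : Type} [CommRing R] (P : ChainComplex (ModuleCat.{0} R) ℕ)
    (hP : ∀ i, Module.Flat R (P.X i)) (S : ShortComplex (ModuleCat.{0} R)) (hS : S.ShortExact) :
    ∃ h : tcxMap P S.f ≫ tcxMap P S.g = 0,
      (ShortComplex.mk (tcxMap P S.f) (tcxMap P S.g) h).ShortExact := by
  have h : tcxMap P S.f ≫ tcxMap P S.g = 0 := by
    rw [← tcxMap_comp, S.zero]
    ext i : 1
    rw [tcxMap_f, MonoidalPreadditive.zero_whiskerRight]
    rfl
  refine ⟨h, HomologicalComplex.shortExact_of_degreewise_shortExact _ fun i => ?_⟩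
  have := hP i
  exact hS.map_of_exact (MonoidalCategory.tensorRight (P.X i))

lemma tcx_flat {R : Type} [CommRing R] {N : ModuleCat.{0} R} (P : ProjectiveResolution N)
    (F : ModuleCat.{0} R) [Module.Flat R F] (i : ℕ) :
    Limits.IsZero ((tcx P.complex F).homology (i+1)) := by
  rw [← HomologicalComplex.exactAt_iff_isZero_homology,
    HomologicalComplex.exactAt_iff' _ (i + 2) (i + 1) i (by simp) (by simp)]
  have h := Module.Flat.lTensor_shortComplex_exact F
    (ShortComplex.mk _ _ (P.complex.d_comp_d (i + 2) (i + 1) i)) (P.exact_succ i)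
  rw [ShortComplex.ShortExact.moduleCat_exact_iff_function_exact] at h ⊢
  exact h

lemma flat_of_res {R : Type} [CommRing R] {N : ModuleCat.{0} R} (P : ProjectiveResolution N)
    (i : ℕ) : Module.Flat R (P.complex.X i) := by
  have h := P.projective i
  rw [← IsProjective.iff_projective] at h
  infer_instance

def torIso {R : Type} [CommRing R] {N : ModuleCat.{0} R} (P : ProjectiveResolution N)
    (A : ModuleCat.{0} R) (i : ℕ) :
    ((Tor (ModuleCat.{0} R) i).obj A).obj N ≅ (tcx P.complex A).homology i :=
  P.isoLeftDerivedObj _ i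

/-- Dimension shifting. -/
lemma tor_shift {R : Type} [CommRing R] (S : ShortComplex (ModuleCat.{0} R)) (hS : S.ShortExact)
    [Module.Flat R S.X₂] (N : ModuleCat.{0} R) (i : ℕ) :
    Nonempty (((Tor (ModuleCat.{0} R) (i+2)).obj S.X₃).obj N ≅
      ((Tor (ModuleCat.{0} R) (i+1)).obj S.X₁).obj N) := by
  let P := projectiveResolution N
  obtain ⟨h, hT⟩ := tcx_shortExact P.complex (flat_of_res P) S hS
  exact ⟨torIso P _ _ ≪≫ hT.δIso (i+2) (i+1) (by simp) (tcx_flat P S.X₂ _) (tcx_flat P S.X₂ _) ≪≫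
    (torIso P _ _).symm⟩

lemma tor_shift_zero {R : Type} [CommRing R] (S : ShortComplex (ModuleCat.{0} R))
    (hS : S.ShortExact) [Module.Flat R S.X₂] (N : ModuleCat.{0} R) :
    ∃ f : ((Tor (ModuleCat.{0} R) 1).obj S.X₃).obj N ⟶ 
      (MonoidalCategoryStruct.tensorObj S.X₁ N), Mono f := by
  let P := projectiveResolution N
  obtain ⟨h, hT⟩ := tcx_shortExact P.complex (flat_of_res P) S hS
  have := hT.mono_δ 1 0 (by simp) (tcx_flat P S.X₂ _)
  let e : (tcx P.complex S.X₁).homology 0 ≅ MonoidalCategoryStruct.tensorObj S.X₁ N :=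
    (torIso P _ _).symm ≪≫
    (((MonoidalCategory.tensoringLeft (ModuleCat.{0} R)).obj S.X₁).leftDerivedZeroIsoSelf.app N)
  exact ⟨(torIso P _ _).hom ≫ hT.δ 1 0 (by simp) ≫ e.hom, mono_comp' inferInstance
    (mono_comp' this inferInstance)⟩

lemma homMap_smul {R : Type} [CommRing R] {K L : ChainComplex (ModuleCat.{0} R) ℕ} (φ : K ⟶ L)
    (s : R) (i : ℕ) : HomologicalComplex.homologyMap (s • φ) i =
      s • HomologicalComplex.homologyMap φ i :=
  ShortComplex.homologyMap_smul
    (φ := (HomologicalComplex.shortComplexFunctor (ModuleCat.{0} R) (ComplexShape.down ℕ) i).map φ) s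

lemma kill_of_iso {R : Type} [CommRing R] {X Y : ModuleCat.{0} R} (e : X ≅ Y) (s : R)
    (h : s • 𝟙 Y = 0) (x : X) : s • x = 0 := by
  have h1 : s • 𝟙 X = 0 := by
    have : s • 𝟙 X = e.hom ≫ (s • 𝟙 Y) ≫ e.inv := by simp
    rw [this, h]; simp
  exact congr($(h1).hom x)

/-- Annihilation. -/
lemma tor_kill {R : Type} [CommRing R] {A F : ModuleCat.{0} R} [Module.Flat R F]
    (h : A ⟶ F) (g : F ⟶ A) (s : R) (e : h ≫ g = s • 𝟙 A) (N : ModuleCat.{0} R) (i : ℕ)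
    (x : ((Tor (ModuleCat.{0} R) (i+1)).obj A).obj N) : s • x = 0 := by
  let P := projectiveResolution N
  have h1 : s • 𝟙 ((tcx P.complex A).homology (i+1)) = 0 := by
    have h2 : HomologicalComplex.homologyMap (tcxMap P.complex (h ≫ g)) (i+1) = 0 := by
      rw [tcxMap_comp, HomologicalComplex.homologyMap_comp,
        (tcx_flat P F i).eq_of_tgt (HomologicalComplex.homologyMap (tcxMap P.complex h) (i+1)) 0]
      simp
    rw [e, tcxMap_smul] at h2
    rw [← h2, ← HomologicalComplex.homologyMap_id]
    exact (homMap_smul _ s (i+1)).symm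
  exact kill_of_iso (torIso P A (i+1)) s h1 x

/-- The sequence `0 → ker g → R^n → M → 0`. -/
abbrev sesK {R : Type} [CommRing R] {n : ℕ} {M : Type} [AddCommGroup M] [Module R M]
    (g : (Fin n → R) →ₗ[R] M) : ShortComplex (ModuleCat.{0} R) :=
  ShortComplex.mk (ModuleCat.ofHom (LinearMap.ker g).subtype) (ModuleCat.ofHom g) (by
    ext x
    exact x.2)

lemma sesKer {R : Type} [CommRing R] {n : ℕ} {M : Type} [AddCommGroup M] [Module R M]
    (g : (Fin n → R) →ₗ[R] M) (hg : Function.Surjective g) : (sesK g).ShortExact where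
  exact := by
    rw [ShortComplex.ShortExact.moduleCat_exact_iff_function_exact]
    exact LinearMap.exact_subtype_ker_map g
  mono_f := (ModuleCat.mono_iff_injective _).2 (LinearMap.ker g).injective_subtype
  epi_g := (ModuleCat.epi_iff_surjective _).2 hg

lemma finLen {R : Type} [CommRing R] [IsNoetherianRing R] [IsLocalRing R]
    (X : Type) [AddCommGroup X] [Module R X] [Module.Finite R X]
    (h : ∀ p : Ideal R, p.IsPrime → p ≠ maximalIdeal R → ∃ s, s ∉ p ∧ ∀ x : X, s • x = 0) :
    IsFiniteLength R X := by
  rw [isFiniteLength_iff_isNoetherian_isArtinian]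
  refine ⟨inferInstance, ?_⟩
  let I := Module.annihilator R X
  have hprime : ∀ p : Ideal R, p.IsPrime → I ≤ p → p = maximalIdeal R := by
    intro p hp hI
    by_contra hne
    obtain ⟨s, hs, hk⟩ := h p hp hne
    exact hs (hI (Module.mem_annihilator.2 hk))
  have hart : IsArtinianRing (R ⧸ I) := by
    rw [isArtinianRing_iff_krullDimLE_zero]
    refine Ring.KrullDimLE.mk₀ fun J hJ => ?_
    have h1 := hprime (J.comap (Ideal.Quotient.mk I)) inferInstance (by
      intro x hx
      simp [Ideal.mem_comap, Ideal.Quotient.eq_zero_iff_mem.2 hx])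
    have h2 : (J.comap (Ideal.Quotient.mk I)).IsMaximal := h1 ▸ inferInstance
    rw [← J.map_comap_of_surjective _ Ideal.Quotient.mk_surjective]
    refine (Ideal.map_eq_top_or_isMaximal_of_surjective _ Ideal.Quotient.mk_surjective
      h2).resolve_left ?_
    rw [J.map_comap_of_surjective _ Ideal.Quotient.mk_surjective]
    exact hJ.ne_top
  let : Module (R ⧸ I) X := (Module.isTorsionBySet_annihilator R X).module
  have : IsScalarTower R (R ⧸ I) X := (Module.isTorsionBySet_annihilator R X).isScalarTower
  have : Module.Finite (R ⧸ I) X := Module.Finite.of_restrictScalars_finite R _ _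
  have : IsArtinian (R ⧸ I) X := inferInstance
  exact isArtinian_of_surjective_algebraMap (R := R ⧸ I) Ideal.Quotient.mk_surjective

lemma exists_kill {R : Type} [CommRing R] [IsNoetherianRing R]
    (M : Type) [AddCommGroup M] [Module R M] [Module.Finite R M] (n : ℕ)
    (g : (Fin n → R) →ₗ[R] M) (hg : Function.Surjective g)
    (p : Ideal R) [p.IsPrime]
    (hf : Module.Free (Localization.AtPrime p) (LocalizedModule p.primeCompl M)) :
    ∃ s, s ∉ p ∧ ∃ h : M →ₗ[R] (Fin n → R), g ∘ₗ h = s • LinearMap.id := by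
  let S := p.primeCompl
  let fM := LocalizedModule.mkLinearMap S M
  let fF := LocalizedModule.mkLinearMap S (Fin n → R)
  let G := LocalizedModule.map S g
  have hG : Function.Surjective G := LocalizedModule.map_surjective S g hg
  obtain ⟨σ, hσ⟩ := Module.projective_lifting_property G LinearMap.id hG
  have : Module.FinitePresentation R M := Module.finitePresentation_of_finite R M
  obtain ⟨h, s, hs⟩ := Module.FinitePresentation.exists_lift_of_isLocalizedModule S fF
    ((σ.restrictScalars R) ∘ₗ fM)
  obtain ⟨t, ht⟩ := Module.Finite.exists_smul_of_comp_eq_of_isLocalizedModule S fM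
    (g ∘ₗ h) (s • LinearMap.id) (by
      ext x
      have h1 : fF (h x) = s • σ (fM x) := congr($hs x)
      have h2 : fM (g (h x)) = G (fF (h x)) := by simp [fM, fF, G]
      have h3 : G (σ (fM x)) = fM x := congr($hσ (fM x))
      change fM (g (h x)) = fM (s • x)
      rw [h2, h1]
      change (G.restrictScalars R) ((s : R) • _) = fM ((s : R) • x)
      rw [map_smul, map_smul]
      exact congrArg _ h3)
  refine ⟨t * s, (t * s).2, (t : R) • h, ?_⟩
  ext x
  have := congr($ht x)
  simpa [mul_smul, Submonoid.smul_def] using this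


lemma tor_finite {R : Type} [CommRing R] [IsNoetherianRing R] (N : Type) [AddCommGroup N]
    [Module R N] [Module.Finite R N] (i : ℕ) :
    ∀ (M : Type) [AddCommGroup M] [Module R M] [Module.Finite R M],
      Module.Finite R (TorM R (i+1) M N) := by
  induction i with
  | zero =>
    intro M _ _ _
    obtain ⟨n, g, hg⟩ := Module.Finite.exists_fin' R M
    obtain ⟨f, hf⟩ := tor_shift_zero _ (sesKer g hg) (ModuleCat.of R N)
    rw [ModuleCat.mono_iff_injective] at hf
    have : IsNoetherian R (TensorProduct R (LinearMap.ker g) N) :=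
      isNoetherian_of_isNoetherianRing_of_finite R (TensorProduct R (LinearMap.ker g) N)
    exact Module.Finite.of_injective (N := TensorProduct R (LinearMap.ker g) N) f.hom hf
  | succ i ih =>
    intro M _ _ _
    obtain ⟨n, g, hg⟩ := Module.Finite.exists_fin' R M
    obtain ⟨e⟩ := tor_shift _ (sesKer g hg) (ModuleCat.of R N) i
    have := ih (LinearMap.ker g)
    exact Module.Finite.equiv e.symm.toLinearEquiv

lemma tor_shift' {R : Type} [CommRing R] {n : ℕ} {K M : Type} [AddCommGroup M] [Module R M]
    [AddCommGroup K] [Module R K]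
    (g : (Fin n → R) →ₗ[R] M) (hg : Function.Surjective g) (eK : K ≃ₗ[R] LinearMap.ker g)
    (N : Type) [AddCommGroup N] [Module R N] (i : ℕ) :
    Nonempty (TorM R (i+2) M N ≃ₗ[R] TorM R (i+1) K N) := by
  obtain ⟨e⟩ := tor_shift _ (sesKer g hg) (ModuleCat.of R N) i
  exact ⟨(e ≪≫ ((Tor (ModuleCat.{0} R) (i+1)).mapIso
    eK.toModuleIso.symm).app (ModuleCat.of R N)).toLinearEquiv⟩

end

theorem tor_periodicity_and_finite_length
    (R : Type) [CommRing R] [IsNoetherianRing R] [IsLocalRing R]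
    (M : Type) [AddCommGroup M] [Module R M] [Module.Finite R M]
    (hper : IsPeriodicSyzygy R M 2) (hloc : LocFreePunctured R M) :
    ∀ (N : Type) [AddCommGroup N] [Module R N] [Module.Finite R N],
      ∀ i : ℕ, 1 ≤ i →
        Nonempty (TorM R i M N ≃ₗ[R] TorM R (i + 2) M N) ∧
        IsFiniteLength R (TorM R i M N) := by
  intro N _ _ _ i hi
  obtain ⟨i, rfl⟩ : ∃ j, i = j + 1 := ⟨i - 1, by omega⟩
  obtain ⟨n, d, g, hg, h0, hd, -, -, ⟨e⟩⟩ := hper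
  constructor
  · obtain ⟨e1⟩ := tor_shift' g hg (LinearEquiv.ofEq _ _ h0.symm) N (i + 1)
    have hk : LinearMap.range (d 1) = LinearMap.ker (d 0).rangeRestrict := by
      rw [LinearMap.ker_rangeRestrict, hd 0]
    obtain ⟨e2⟩ := tor_shift' (d 0).rangeRestrict (LinearMap.surjective_rangeRestrict _)
      (e ≪≫ₗ LinearEquiv.ofEq _ _ hk) N i
    exact ⟨(e1 ≪≫ₗ e2).symm⟩
  · have := tor_finite (R := R) N i M
    refine finLen _ fun p hp hne => ?_
    obtain ⟨s, hs, h, hh⟩ := exists_kill M (n 0) g hg p (hloc p hp hne)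
    refine ⟨s, hs, fun x => ?_⟩
    exact tor_kill (A := ModuleCat.of R M) (F := ModuleCat.of R (Fin (n 0) → R))
      (ModuleCat.ofHom h) (ModuleCat.ofHom g) s (by
        ext x
        exact congr($hh x)) (ModuleCat.of R N) i x
end

section
/- Let R be a commutative Noetherian local ring and M a finitely generated R-module with M ≅ Ω²M, locally free on the punctured spectrum. If N is a finitely generated R-module whose class is zero in the reduced Grothendieck group with rational coefficients, and Tor_n^R(M,N) = 0 for some n ≥ 1, then Tor_{n+1}^R(M,N) = 0, and consequently Tor_i^R(M,N) = 0 for all i ≥ n. -/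
open CategoryTheory IsLocalRing

open TensorProduct

namespace TorRig

/-- The cyclic complex shape with two vertices. -/
def sh : ComplexShape Bool where
  Rel i j := j = !i
  next_eq := by intro i j k h1 h2; rw [h1, h2]
  prev_eq := by intro i j k h1 h2; cases i <;> cases j <;> simp_all

lemma sh_rel (i : Bool) : sh.Rel i (!i) := rfl
lemma sh_rel' (i : Bool) : sh.Rel (!i) i := (Bool.not_not i).symm
lemma sh_next (i : Bool) : sh.next i = !i := sh.next_eq' (sh_rel i)
lemma sh_prev (i : Bool) : sh.prev i = !i := sh.prev_eq' (sh_rel' i)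

/-- A two-periodic exact complex of finite free modules. -/
structure Per (R : Type) [CommRing R] where
  m : Bool → ℕ
  D : ∀ b c : Bool, (Fin (m b) → R) →ₗ[R] (Fin (m c) → R)
  zero : ∀ b, D b b = 0
  exact : ∀ b, Function.Exact (D (!b) b) (D b (!b))

variable {R : Type} [CommRing R]

/-- The free module in position `b`. -/
abbrev Per.C (S : Per R) (b : Bool) : Type := Fin (S.m b) → R

/-- The two-periodic complex tensored with `N`. -/
noncomputable def Per.cx (S : Per R) (N : Type) [AddCommGroup N] [Module R N] :
    HomologicalComplex (ModuleCat.{0} R) sh where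
  X b := ModuleCat.of R (S.C b ⊗[R] N)
  d i j := ModuleCat.ofHom ((S.D i j).rTensor N)
  shape i j h := by
    have : j = i := by
      change ¬ (j = !i) at h
      cases i <;> cases j <;> simp_all
    subst this
    rw [S.zero]; simp
  d_comp_d' i j k h1 h2 := by
    change j = !i at h1
    change k = !j at h2
    obtain rfl : k = i := by rw [h2, h1, Bool.not_not]
    subst h1
    rw [← ModuleCat.ofHom_comp, ← LinearMap.rTensor_comp]
    have := (S.exact (!k)).linearMap_comp_eq_zero
    rw [Bool.not_not] at this
    rw [this]; simp

/-- Functoriality of the complex. -/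
noncomputable def Per.map (S : Per R) {N N' : Type} [AddCommGroup N] [Module R N]
    [AddCommGroup N'] [Module R N'] (f : N →ₗ[R] N') : S.cx N ⟶ S.cx N' where
  f b := ModuleCat.ofHom (f.lTensor (S.C b))
  comm' i j _ := by
    change ModuleCat.ofHom _ ≫ ModuleCat.ofHom _ = ModuleCat.ofHom _ ≫ ModuleCat.ofHom _
    rw [← ModuleCat.ofHom_comp, ← ModuleCat.ofHom_comp]
    congr 1
    rw [LinearMap.rTensor_comp_lTensor, LinearMap.lTensor_comp_rTensor]

/-- Homology. -/
noncomputable abbrev Per.H (S : Per R) (N : Type) [AddCommGroup N] [Module R N] (b : Bool) :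
    ModuleCat.{0} R := (S.cx N).homology b

lemma isZero_iff_sub (X : ModuleCat.{0} R) : Limits.IsZero X ↔ Subsingleton X :=
  ModuleCat.isZero_iff_subsingleton

lemma Per.sub_iff (S : Per R) (N : Type) [AddCommGroup N] [Module R N] (b : Bool) :
    Subsingleton (S.H N b) ↔
      ∀ x : S.C b ⊗[R] N, (S.D b (!b)).rTensor N x = 0 →
        ∃ y, (S.D (!b) b).rTensor N y = x := by
  rw [← isZero_iff_sub, ← HomologicalComplex.exactAt_iff_isZero_homology,
    HomologicalComplex.exactAt_iff' _ (!b) b (!b) (sh_prev b) (sh_next b),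
    ShortComplex.moduleCat_exact_iff]
  rfl

lemma Per.sub_of_flat (S : Per R) (N : Type) [AddCommGroup N] [Module R N] [Module.Flat R N]
    (b : Bool) : Subsingleton (S.H N b) := by
  rw [S.sub_iff]
  intro x hx
  exact (Module.Flat.rTensor_exact N (S.exact b) x).1 hx

/-- Short exact sequence of complexes. -/
noncomputable def Per.sc (S : Per R) {N₁ N₂ N₃ : Type} [AddCommGroup N₁] [Module R N₁]
    [AddCommGroup N₂] [Module R N₂] [AddCommGroup N₃] [Module R N₃]
    (f : N₁ →ₗ[R] N₂) (g : N₂ →ₗ[R] N₃) (h : Function.Exact f g) :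
    ShortComplex (HomologicalComplex (ModuleCat.{0} R) sh) :=
  ShortComplex.mk (S.map f) (S.map g) (by
    ext b : 1
    change ModuleCat.ofHom _ ≫ ModuleCat.ofHom _ = 0
    rw [← ModuleCat.ofHom_comp, ← LinearMap.lTensor_comp, h.linearMap_comp_eq_zero]
    simp)

section
variable (S : Per R) {N₁ N₂ N₃ : Type} [AddCommGroup N₁] [Module R N₁]
    [AddCommGroup N₂] [Module R N₂] [AddCommGroup N₃] [Module R N₃]
    (f : N₁ →ₗ[R] N₂) (g : N₂ →ₗ[R] N₃)

lemma Per.sc_se (h : Function.Exact f g) (hf : Function.Injective f)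
    (hg : Function.Surjective g) : (S.sc f g h).ShortExact := by
  apply HomologicalComplex.shortExact_of_degreewise_shortExact
  intro b
  apply ModuleCat.shortComplex_shortExact
  · exact lTensor_exact (S.C b) h hg
  · exact Module.Flat.lTensor_preserves_injective_linearMap (M := S.C b) f hf
  · exact LinearMap.lTensor_surjective (S.C b) hg

/-- The exact hexagon. -/
lemma Per.hexagon (h : Function.Exact f g) (hf : Function.Injective f)
    (hg : Function.Surjective g) :
    ∃ (a : ∀ b, S.H N₁ b →ₗ[R] S.H N₂ b) (c : ∀ b, S.H N₂ b →ₗ[R] S.H N₃ b)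
    (δ : ∀ b, S.H N₃ b →ₗ[R] S.H N₁ (!b)),
    (∀ b, Function.Exact (a b) (c b)) ∧ (∀ b, Function.Exact (c b) (δ b)) ∧
    (∀ b, Function.Exact (δ b) (a (!b))) := by
  have se := S.sc_se f g h hf hg
  refine ⟨fun b => (HomologicalComplex.homologyMap (S.sc f g h).f b).hom,
    fun b => (HomologicalComplex.homologyMap (S.sc f g h).g b).hom,
    fun b => (se.δ b (!b) (sh_rel b)).hom, fun b => ?_, fun b => ?_, fun b => ?_⟩
  · exact (ShortComplex.ShortExact.moduleCat_exact_iff_function_exact _).1 (se.homology_exact₂ b)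
  · exact (ShortComplex.ShortExact.moduleCat_exact_iff_function_exact _).1
      (se.homology_exact₃ b (!b) (sh_rel b))
  · exact (ShortComplex.ShortExact.moduleCat_exact_iff_function_exact _).1
      (se.homology_exact₁ b (!b) (sh_rel b))

lemma Per.shift (h : Function.Exact f g) (hf : Function.Injective f)
    (hg : Function.Surjective g) [Module.Flat R N₂] (b : Bool) :
    Subsingleton (S.H N₃ b) ↔ Subsingleton (S.H N₁ (!b)) := by
  obtain ⟨a, c, δ, h1, h2, h3⟩ := S.hexagon f g h hf hg
  have i1 := S.sub_of_flat N₂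
  constructor
  · intro hs
    refine ⟨fun x y => ?_⟩
    obtain ⟨x', rfl⟩ := (h3 b x).1 (Subsingleton.elim _ _)
    obtain ⟨y', rfl⟩ := (h3 b y).1 (Subsingleton.elim _ _)
    rw [Subsingleton.elim x' y']
  · intro hs
    refine ⟨fun x y => ?_⟩
    obtain ⟨x', rfl⟩ := (h2 b x).1 (Subsingleton.elim _ _)
    obtain ⟨y', rfl⟩ := (h2 b y).1 (Subsingleton.elim _ _)
    rw [Subsingleton.elim x' y']

lemma len_mid (h : Function.Exact f g) : Module.length R N₂ =
    Module.length R (LinearMap.range f) + Module.length R (LinearMap.range g) := by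
  refine Module.length_eq_add_of_exact (LinearMap.range f).subtype g.rangeRestrict
    (Submodule.subtype_injective _) g.surjective_rangeRestrict ?_
  intro x
  rw [← LinearMap.mem_ker, LinearMap.ker_rangeRestrict, LinearMap.mem_ker, h x]
  simp

lemma Per.len_add (h : Function.Exact f g) (hf : Function.Injective f)
    (hg : Function.Surjective g)
    (hfin : ∀ b, Module.length R (S.H N₁ b) ≠ ⊤ ∧ Module.length R (S.H N₂ b) ≠ ⊤ ∧
    Module.length R (S.H N₃ b) ≠ ⊤) :
    (((Module.length R (S.H N₂ false)).toNat : ℚ) - (Module.length R (S.H N₂ true)).toNat) =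
    (((Module.length R (S.H N₁ false)).toNat : ℚ) - (Module.length R (S.H N₁ true)).toNat) +
    (((Module.length R (S.H N₃ false)).toNat : ℚ) - (Module.length R (S.H N₃ true)).toNat) := by
  obtain ⟨a, c, δ, h1, h2, h3⟩ := S.hexagon f g h hf hg
  have key : ∀ (l r₁ r₂ : ℕ∞), l = r₁ + r₂ → l ≠ ⊤ → (l.toNat : ℚ) = r₁.toNat + r₂.toNat := by
    intro l r₁ r₂ e hl
    subst e
    rw [ENat.toNat_add]
    · push_cast; rfl
    · rintro rfl; simp at hl
    · rintro rfl; simp at hl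
  let ra : Bool → ℚ := fun b => ((Module.length R (LinearMap.range (a b))).toNat : ℚ)
  let rc : Bool → ℚ := fun b => ((Module.length R (LinearMap.range (c b))).toNat : ℚ)
  let rd : Bool → ℚ := fun b => ((Module.length R (LinearMap.range (δ b))).toNat : ℚ)
  have e1 : ((Module.length R (S.H N₂ false)).toNat : ℚ) = ra false + rc false :=
    key _ _ _ (len_mid _ _ (h1 false)) (hfin false).2.1
  have e2 : ((Module.length R (S.H N₂ true)).toNat : ℚ) = ra true + rc true :=
    key _ _ _ (len_mid _ _ (h1 true)) (hfin true).2.1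
  have e3 : ((Module.length R (S.H N₃ false)).toNat : ℚ) = rc false + rd false :=
    key _ _ _ (len_mid _ _ (h2 false)) (hfin false).2.2
  have e4 : ((Module.length R (S.H N₃ true)).toNat : ℚ) = rc true + rd true :=
    key _ _ _ (len_mid _ _ (h2 true)) (hfin true).2.2
  have e5 : ((Module.length R (S.H N₁ true)).toNat : ℚ) = rd false + ra true :=
    key _ _ _ (len_mid _ _ (h3 false)) (hfin true).1
  have e6 : ((Module.length R (S.H N₁ false)).toNat : ℚ) = rd true + ra false :=
    key _ _ _ (len_mid _ _ (h3 true)) (hfin false).1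
  rw [e1, e2, e3, e4, e5, e6]
  ring
end

/-- Multiplication by `s` is null-homotopic. -/
def Per.Null (S : Per R) (s : R) : Prop :=
  ∀ b, ∃ (σ : S.C b →ₗ[R] S.C (!b)) (ρ : S.C (!b) →ₗ[R] S.C b),
    s • LinearMap.id = S.D (!b) b ∘ₗ σ + ρ ∘ₗ S.D b (!b)

lemma Per.smul_eq_zero (S : Per R) {s : R} (hs : S.Null s) (N : Type) [AddCommGroup N]
    [Module R N] (b : Bool) (y : S.H N b) : s • y = 0 := by
  obtain ⟨σ, ρ, h⟩ := hs b
  have surj : Function.Surjective ((S.cx N).homologyπ b) :=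
    (ModuleCat.epi_iff_surjective _).1 inferInstance
  have inj : Function.Injective ((S.cx N).iCycles b) :=
    (ModuleCat.mono_iff_injective _).1 inferInstance
  obtain ⟨z, rfl⟩ := surj y
  have hz : (S.D b (!b)).rTensor N ((S.cx N).iCycles b z) = 0 := by
    have := congrArg (fun f => f.hom z) ((S.cx N).iCycles_d b (!b))
    exact this
  let x : S.C b ⊗[R] N := (S.cx N).iCycles b z
  have h' : s • x = (S.D (!b) b).rTensor N (σ.rTensor N x) := by
    have := congrArg (fun f => LinearMap.rTensor N f x) h
    simp only [LinearMap.rTensor_add, LinearMap.rTensor_comp, LinearMap.rTensor_smul,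
      LinearMap.rTensor_id, LinearMap.add_apply, LinearMap.comp_apply, LinearMap.smul_apply,
      LinearMap.id_apply] at this
    rw [this]
    change _ + ρ.rTensor N ((S.D b (!b)).rTensor N ((S.cx N).iCycles b z)) = _
    rw [hz, map_zero, add_zero]
  have h2 : s • z = (S.cx N).toCycles (!b) b (σ.rTensor N x) := by
    apply inj
    have := congrArg (fun f => f.hom (σ.rTensor N x)) ((S.cx N).toCycles_i (!b) b)
    refine Eq.trans ?_ (Eq.trans h' this.symm)
    exact map_smul ((S.cx N).iCycles b).hom s z
  have h3 := congrArg (fun f => f.hom (σ.rTensor N x)) ((S.cx N).toCycles_comp_homologyπ (!b) b)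
  refine Eq.trans (map_smul ((S.cx N).homologyπ b).hom s z).symm ?_
  rw [h2]
  exact h3

instance Per.finite [IsNoetherianRing R] (S : Per R) (N : Type) [AddCommGroup N]
    [Module R N] [Module.Finite R N] (b : Bool) : Module.Finite R (S.H N b) := by
  have surj : Function.Surjective ((S.cx N).homologyπ b) :=
    (ModuleCat.epi_iff_surjective _).1 inferInstance
  have inj : Function.Injective ((S.cx N).iCycles b) :=
    (ModuleCat.mono_iff_injective _).1 inferInstance
  have : IsNoetherian R ((S.cx N).X b) :=
    inferInstanceAs (IsNoetherian R (S.C b ⊗[R] N))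
  have : IsNoetherian R ((S.cx N).cycles b) :=
    isNoetherian_of_injective ((S.cx N).iCycles b).hom inj
  exact Module.Finite.of_surjective ((S.cx N).homologyπ b).hom surj

lemma finLen [IsNoetherianRing R] [IsLocalRing R] (H : Type) [AddCommGroup H] [Module R H]
    [Module.Finite R H]
    (h : ∀ p : Ideal R, p.IsPrime → p ≠ maximalIdeal R → ∃ s ∉ p, ∀ y : H, s • y = 0) :
    Module.length R H ≠ ⊤ := by
  revert h
  refine IsNoetherianRing.induction_on_isQuotientEquivQuotientPrime (A := R) (M := H)
    inferInstance (motive := fun H _ _ _ =>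
    (∀ p : Ideal R, p.IsPrime → p ≠ maximalIdeal R → ∃ s ∉ p, ∀ y : H, s • y = 0) →
    Module.length R H ≠ ⊤) ?_ ?_ ?_
  · intro N _ _ _ _ _
    rw [Module.length_eq_zero]; simp
  · intro N _ _ _ p e h
    by_cases hp : p.1 = maximalIdeal R
    · have : IsSimpleModule R (R ⧸ p.1) := by
        rw [isSimpleModule_iff_isCoatom]
        rw [hp]; exact (maximalIdeal.isMaximal R).out
      rw [e.length_eq, Module.length_eq_one]; simp
    · obtain ⟨s, hs, h0⟩ := h p.1 p.2 hp
      exfalso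
      apply hs
      have := h0 (e.symm (Ideal.Quotient.mk p.1 1))
      rw [← map_smul, LinearEquiv.map_eq_zero_iff] at this
      rw [← Ideal.Quotient.eq_zero_iff_mem, ← this]
      simp [Algebra.smul_def]
  · intro N₁ _ _ _ N₂ _ _ _ N₃ _ _ _ f g hf hg hfg h1 h3 h
    rw [Module.length_eq_add_of_exact f g hf hg hfg]
    have a1 := h1 (fun p hp hm => by
      obtain ⟨s, hs, h0⟩ := h p hp hm
      exact ⟨s, hs, fun y => hf (by rw [map_smul, h0, map_zero])⟩)
    have a3 := h3 (fun p hp hm => by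
      obtain ⟨s, hs, h0⟩ := h p hp hm
      refine ⟨s, hs, fun y => ?_⟩
      obtain ⟨x, rfl⟩ := hg y
      rw [← map_smul, h0, map_zero])
    simp [a1, a3]

lemma exists_split [IsNoetherianRing R] {F M : Type} [AddCommGroup F] [Module R F]
    [AddCommGroup M] [Module R M] [Module.Finite R M] (g : F →ₗ[R] M)
    (hg : Function.Surjective g) (p : Ideal R) [p.IsPrime]
    (hfree : Module.Free (Localization.AtPrime p) (LocalizedModule p.primeCompl M)) :
    ∃ s ∉ p, ∃ h : M →ₗ[R] F, g ∘ₗ h = s • LinearMap.id := by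
  let gp := LocalizedModule.map p.primeCompl g
  have hgp : Function.Surjective gp := LocalizedModule.map_surjective p.primeCompl g hg
  obtain ⟨t, ht⟩ := Module.projective_lifting_property gp LinearMap.id hgp
  have : Module.FinitePresentation R M := Module.finitePresentation_of_finite R M
  obtain ⟨h, s, hs⟩ := Module.FinitePresentation.exists_lift_of_isLocalizedModule p.primeCompl
    (LocalizedModule.mkLinearMap p.primeCompl F)
    ((t.restrictScalars R) ∘ₗ LocalizedModule.mkLinearMap p.primeCompl M)
  have e : LocalizedModule.mkLinearMap p.primeCompl M ∘ₗ (g ∘ₗ h) =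
      LocalizedModule.mkLinearMap p.primeCompl M ∘ₗ ((s : R) • LinearMap.id) := by
    ext x
    have h1 := LinearMap.congr_fun hs x
    have h2 : gp (LocalizedModule.mkLinearMap p.primeCompl F (h x)) =
      LocalizedModule.mkLinearMap p.primeCompl M (g (h x)) := by
      simp [gp, LocalizedModule.mkLinearMap_apply]
    have h3 := LinearMap.congr_fun ht (LocalizedModule.mkLinearMap p.primeCompl M x)
    simp only [LinearMap.comp_apply] at h1 ⊢
    rw [← h2, h1]
    change gp ((s : R) • t _) = _
    simp only [LinearMap.comp_apply, LinearMap.id_apply] at h3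
    have h4 : gp ((s : R) • t (LocalizedModule.mkLinearMap p.primeCompl M x)) =
      (s : R) • gp (t (LocalizedModule.mkLinearMap p.primeCompl M x)) :=
      map_smul (gp.restrictScalars R) _ _
    rw [h4, h3]
    simp
  obtain ⟨s', hs'⟩ := Module.Finite.exists_smul_of_comp_eq_of_isLocalizedModule p.primeCompl
    (LocalizedModule.mkLinearMap p.primeCompl M) _ _ e
  refine ⟨s' * s, (s' * s).2, (s' : R) • h, ?_⟩
  rw [LinearMap.comp_smul, mul_smul]
  exact hs'

lemma lift_of_exact {n : ℕ} {B A C : Type} [AddCommGroup B] [Module R B] [AddCommGroup A]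
    [Module R A] [AddCommGroup C] [Module R C] {d : B →ₗ[R] A} {e : A →ₗ[R] C}
    (h : Function.Exact d e) (φ : (Fin n → R) →ₗ[R] A) (hφ : e ∘ₗ φ = 0) :
    ∃ σ : (Fin n → R) →ₗ[R] B, d ∘ₗ σ = φ := by
  have hm : ∀ x, φ x ∈ LinearMap.range d := fun x => (h _).1 (LinearMap.congr_fun hφ x)
  obtain ⟨σ, hσ⟩ := Module.projective_lifting_property d.rangeRestrict
    (φ.codRestrict _ hm) d.surjective_rangeRestrict
  refine ⟨σ, ?_⟩
  ext1 x
  ext1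
  exact congrArg Subtype.val (LinearMap.congr_fun hσ _)

lemma Per.null_of_split (S : Per R) {M : Type} [AddCommGroup M] [Module R M]
    (g : S.C false →ₗ[R] M) (hdg : Function.Exact (S.D true false) g)
    (s : R) (h : M →ₗ[R] S.C false)
    (hs : g ∘ₗ h = s • LinearMap.id) : S.Null s := by
  have x1 : Function.Exact (S.D false true) (S.D true false) := S.exact true
  have x2 : Function.Exact (S.D true false) (S.D false true) := S.exact false
  have ed := x2.linearMap_comp_eq_zero
  have de := x1.linearMap_comp_eq_zero
  obtain ⟨σ, hσ⟩ := lift_of_exact hdg (s • LinearMap.id - h ∘ₗ g) (by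
    rw [LinearMap.comp_sub, ← LinearMap.comp_assoc, hs]
    refine LinearMap.ext fun x => ?_
    simp)
  obtain ⟨ρ, hρ⟩ := lift_of_exact x1 (s • LinearMap.id - σ ∘ₗ S.D true false) (by
    rw [LinearMap.comp_sub, ← LinearMap.comp_assoc, hσ, LinearMap.sub_comp, LinearMap.comp_assoc,
      hdg.linearMap_comp_eq_zero]
    refine LinearMap.ext fun x => ?_
    simp)
  obtain ⟨τ, hτ⟩ := lift_of_exact x2 (s • LinearMap.id - ρ ∘ₗ S.D false true) (by
    rw [LinearMap.comp_sub, ← LinearMap.comp_assoc, hρ, LinearMap.sub_comp, LinearMap.comp_assoc,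
      de]
    refine LinearMap.ext fun x => ?_
    simp)
  rintro (_ | _)
  · exact ⟨τ, ρ, by
      change _ = S.D true false ∘ₗ τ + ρ ∘ₗ S.D false true
      rw [hτ]; abel⟩
  · exact ⟨ρ, σ, by
      change _ = S.D false true ∘ₗ ρ + σ ∘ₗ S.D true false
      rw [hρ]; abel⟩

/-- `S` is a two-periodic resolution of `M`. -/
structure Per.Res (S : Per R) (M : Type) [AddCommGroup M] [Module R M] where
  g : S.C false →ₗ[R] M
  i : M →ₗ[R] S.C true
  surj : Function.Surjective g
  inj : Function.Injective i
  comp : i ∘ₗ g = S.D false true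
  exact : Function.Exact (S.D true false) g

lemma Per.Res.inj_iff {S : Per R} {M : Type} [AddCommGroup M] [Module R M] (r : S.Res M)
    (K : Type) [AddCommGroup K] [Module R K] :
    Function.Injective (r.i.rTensor K) ↔ Subsingleton (S.H K false) := by
  have ex := rTensor_exact K r.exact r.surj
  have su := LinearMap.rTensor_surjective K r.surj
  have hc : ∀ x, (S.D false true).rTensor K x = r.i.rTensor K (r.g.rTensor K x) := by
    intro x; rw [← r.comp, LinearMap.rTensor_comp]; rfl
  rw [S.sub_iff]
  change _ ↔ ∀ x : S.C false ⊗[R] K, (S.D false true).rTensor K x = 0 →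
        ∃ y, (S.D true false).rTensor K y = x
  constructor
  · intro h x hx
    rw [hc] at hx
    exact (ex x).1 (h (by rw [hx, map_zero]))
  · intro h
    rw [injective_iff_map_eq_zero]
    intro y hy
    obtain ⟨x, rfl⟩ := su y
    rw [← hc] at hy
    exact (ex x).2 (h x hy)

lemma Per.Res.exact_iff {S : Per R} {M : Type} [AddCommGroup M] [Module R M] (r : S.Res M)
    {P₀ P₁ P₂ : Type} [AddCommGroup P₀] [Module R P₀] [AddCommGroup P₁] [Module R P₁]
    [AddCommGroup P₂] [Module R P₂] [Module.Flat R P₀] (f : P₂ →ₗ[R] P₁) (h : P₁ →ₗ[R] P₀)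
    (hfh : Function.Exact f h) :
    (∀ x : M ⊗[R] P₁, h.lTensor M x = 0 → ∃ y, f.lTensor M y = x) ↔
      Subsingleton (S.H (LinearMap.range h) false) := by
  rw [← r.inj_iff]
  let ι := (LinearMap.range h).subtype
  let π := h.rangeRestrict
  have hπ : Function.Surjective π := h.surjective_rangeRestrict
  have hh : h = ι ∘ₗ π := rfl
  have e1 : Function.Exact f π := by
    intro x
    rw [← hfh x]
    change π x = 0 ↔ ι (π x) = 0
    simp [ι]
  have ex := lTensor_exact M e1 hπ
  have su := LinearMap.lTensor_surjective M hπ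
  have hc : ∀ x, h.lTensor M x = ι.lTensor M (π.lTensor M x) := by
    intro x; rw [← LinearMap.comp_apply, ← LinearMap.lTensor_comp]; rfl
  have ia : Function.Injective (ι.lTensor (S.C true)) :=
    Module.Flat.lTensor_preserves_injective_linearMap _ (Submodule.subtype_injective _)
  have ib : Function.Injective (r.i.rTensor P₀) :=
    Module.Flat.rTensor_preserves_injective_linearMap _ r.inj
  have sq : ∀ x, ι.lTensor (S.C true) (r.i.rTensor _ x) = r.i.rTensor P₀ (ι.lTensor M x) := by
    intro x
    have : (ι.lTensor (S.C true)) ∘ₗ (r.i.rTensor _) = (r.i.rTensor P₀) ∘ₗ (ι.lTensor M) := by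
      rw [LinearMap.lTensor_comp_rTensor, LinearMap.rTensor_comp_lTensor]
    exact LinearMap.congr_fun this x
  constructor
  · intro H
    rw [injective_iff_map_eq_zero]
    intro y hy
    obtain ⟨x, rfl⟩ := su y
    refine (ex x).2 (H x ?_)
    rw [hc]
    apply ib
    rw [← sq, hy, map_zero, map_zero]
  · intro H x hx
    refine (ex x).1 (H ?_)
    apply ia
    rw [sq, ← hc, hx]; simp

lemma Per.Res.tor_iff {S : Per R} {M : Type} [AddCommGroup M] [Module R M] (r : S.Res M)
    (N : Type) [AddCommGroup N] [Module R N] (k : ℕ) :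
    Subsingleton (TorM R (k + 1) M N) ↔ Subsingleton (S.H N (k + 1).bodd) := by
  let P := projectiveResolution (ModuleCat.of R N)
  have fl : ∀ j, Module.Flat R (P.complex.X j) := by
    intro j
    have : Module.Projective R (P.complex.X j) :=
      (IsProjective.iff_projective (P.complex.X j)).2 (P.projective j)
    infer_instance
  have ex : ∀ j, Function.Exact (P.complex.d (j + 2) (j + 1)).hom (P.complex.d (j + 1) j).hom :=
    fun j => (ShortComplex.ShortExact.moduleCat_exact_iff_function_exact _).1 (P.exact_succ j)
  -- the augmentation
  have hsurj : Function.Surjective (P.π.f 0).hom :=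
    (ModuleCat.epi_iff_surjective _).1 inferInstance
  have ex0 : Function.Exact (P.complex.d 1 0).hom (P.π.f 0).hom :=
    (ShortComplex.ShortExact.moduleCat_exact_iff_function_exact _).1
      (ShortComplex.exact_of_g_is_cokernel
        (ShortComplex.mk _ _ P.complex_d_comp_π_f_zero) P.isColimitCokernelCofork)
  obtain ⟨ε, hsurj, ex0⟩ : ∃ ε : P.complex.X 0 →ₗ[R] N, Function.Surjective ε ∧
      Function.Exact (P.complex.d 1 0).hom ε := ⟨(P.π.f 0).hom, hsurj, ex0⟩
  have sh : ∀ j b, Subsingleton (S.H (LinearMap.range (P.complex.d (j + 1) j).hom) b) ↔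
      Subsingleton (S.H N (xor b (j + 1).bodd)) := by
    intro j
    induction j with
    | zero =>
      intro b
      have := S.shift (LinearMap.range (P.complex.d 1 0).hom).subtype
        ε
        (by
          intro x
          rw [ex0 x]
          simp) (Submodule.subtype_injective _) hsurj (!b)
      rw [Bool.not_not] at this
      rw [← this]
      simp only [Nat.bodd_succ, Nat.bodd_zero, Bool.not_false, Bool.xor_true, zero_add]
      try exact Iff.rfl
    | succ j ih =>
      intro b
      have := S.shift (LinearMap.range (P.complex.d (j + 2) (j + 1)).hom).subtype
        (P.complex.d (j + 1) j).hom.rangeRestrict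
        (by
          intro x
          rw [← LinearMap.mem_ker, LinearMap.ker_rangeRestrict, LinearMap.mem_ker, ex j x]
          simp) (Submodule.subtype_injective _) (LinearMap.surjective_rangeRestrict _) (!b)
      rw [Bool.not_not] at this
      rw [← this, ih]
      simp
  have key := r.exact_iff _ _ (ex k)
  rw [sh k false, Bool.false_xor] at key
  rw [← key]
  have e := P.isoLeftDerivedObj ((MonoidalCategory.tensoringLeft (ModuleCat R)).obj
    (ModuleCat.of R M)) (k + 1)
  have e1 : Subsingleton (TorM R (k + 1) M N) ↔ Limits.IsZero
    ((HomologicalComplex.homologyFunctor (ModuleCat R) _ (k + 1)).obj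
        ((((MonoidalCategory.tensoringLeft (ModuleCat R)).obj
          (ModuleCat.of R M)).mapHomologicalComplex _).obj P.complex)) := by
    rw [← isZero_iff_sub]
    exact e.isZero_iff
  rw [e1]
  change Limits.IsZero (HomologicalComplex.homology _ _) ↔ _
  rw [← HomologicalComplex.exactAt_iff_isZero_homology,
    HomologicalComplex.exactAt_iff' _ (k + 2) (k + 1) k (by simp) (by simp),
    ShortComplex.moduleCat_exact_iff]
  rfl


/-- The resolution coming from the periodicity hypothesis. -/
lemma exists_res [IsLocalRing R] (M : Type) [AddCommGroup M] [Module R M]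
    (hper : IsPeriodicSyzygy R M 2) : ∃ S : Per R, Nonempty (S.Res M) := by
  obtain ⟨n, d, g, hg, hk, hd, -, -, ⟨e⟩⟩ := hper
  change M ≃ₗ[R] LinearMap.range (d 1) at e
  let i : M →ₗ[R] (Fin (n 1) → R) := (LinearMap.range (d 1)).subtype ∘ₗ e.toLinearMap
  have hi : Function.Injective i := (Submodule.subtype_injective _).comp e.injective
  have hri : ∀ y, y ∈ LinearMap.range (d 1) ↔ ∃ x, i (g x) = y := by
    intro y
    constructor
    · intro hy
      obtain ⟨x, hx⟩ := hg (e.symm ⟨y, hy⟩)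
      exact ⟨x, by rw [hx]; simp [i]⟩
    · rintro ⟨x, rfl⟩
      exact (e (g x)).2
  have x1 : Function.Exact (d 0) (i ∘ₗ g) := by
    intro x
    rw [LinearMap.comp_apply, map_eq_zero_iff i hi, ← LinearMap.mem_ker, hk]
    rfl
  have x2 : Function.Exact (i ∘ₗ g) (d 0) := by
    intro x
    rw [← LinearMap.mem_ker, hd 0]
    exact hri x
  let m : Bool → ℕ := fun b => match b with
    | false => n 0
    | true => n 1
  let D : ∀ b c : Bool, (Fin (m b) → R) →ₗ[R] (Fin (m c) → R) := fun b c => match b, c with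
    | false, false => 0
    | true, true => 0
    | false, true => i ∘ₗ g
    | true, false => d 0
  refine ⟨⟨m, D, ?_, ?_⟩, ⟨⟨g, i, hg, hi, rfl, ?_⟩⟩⟩
  · rintro (_ | _) <;> rfl
  · rintro (_ | _)
    · exact x1
    · exact x2
  · intro x
    rw [← LinearMap.mem_ker, hk]
    rfl

/-- The rational theta-type invariant. -/
noncomputable def Per.chi (S : Per R) (N : Type) [AddCommGroup N] [Module R N] : ℚ :=
  ((Module.length R (S.H N false)).toNat : ℚ) - (Module.length R (S.H N true)).toNat

lemma Per.len_ne_top [IsNoetherianRing R] [IsLocalRing R] {S : Per R} {M : Type}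
    [AddCommGroup M] [Module R M] [Module.Finite R M] (r : S.Res M) (hloc : LocFreePunctured R M)
    (N : Type) [AddCommGroup N] [Module R N] [Module.Finite R N] (b : Bool) :
    Module.length R (S.H N b) ≠ ⊤ := by
  apply finLen
  intro p hp hm
  obtain ⟨s, hs, h, hh⟩ := exists_split r.g r.surj p (hloc p hp hm)
  exact ⟨s, hs, fun y => S.smul_eq_zero (S.null_of_split r.g r.exact s h hh) N b y⟩

lemma Per.chi_zero [IsNoetherianRing R] [IsLocalRing R] {S : Per R} {M : Type}
    [AddCommGroup M] [Module R M] [Module.Finite R M] (r : S.Res M) (hloc : LocFreePunctured R M)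
    (x : FGIdx R)
    (hx : (Submodule.Quotient.mk (p := Submodule.span ℚ (gRelQbar R))
      (Finsupp.single x 1) : GbarQ R) = 0) : S.chi (idxMod R x) = 0 := by
  let χ : (FGIdx R →₀ ℚ) →ₗ[ℚ] ℚ := Finsupp.linearCombination ℚ (fun x => S.chi (idxMod R x))
  have hle : Submodule.span ℚ (gRelQbar R) ≤ LinearMap.ker χ := by
    rw [Submodule.span_le]
    rintro v (⟨x, y, z, f, g, hf, hg, hfg, rfl⟩ | ⟨x, ⟨e⟩, rfl⟩)
    · have := S.len_add f g (LinearMap.exact_iff.2 hfg.symm) hf hg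
        (fun b => ⟨Per.len_ne_top r hloc _ b, Per.len_ne_top r hloc _ b,
          Per.len_ne_top r hloc _ b⟩)
      change S.chi _ = S.chi _ + S.chi _ at this
      simp [χ, this]
    · have : Module.Flat R (idxMod R x) := Module.Flat.of_linearEquiv e
      have h1 := S.sub_of_flat (idxMod R x) false
      have h2 := S.sub_of_flat (idxMod R x) true
      simp [χ, Per.chi, Module.length_eq_zero]
  rw [Submodule.Quotient.mk_eq_zero] at hx
  simpa [χ] using hle hx

lemma Per.all_of_one [IsNoetherianRing R] [IsLocalRing R] {S : Per R} {M : Type}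
    [AddCommGroup M] [Module R M] [Module.Finite R M] (r : S.Res M) (hloc : LocFreePunctured R M)
    (N : Type) [AddCommGroup N] [Module R N] [Module.Finite R N] (h0 : S.chi N = 0)
    (b : Bool) (hb : Subsingleton (S.H N b)) (c : Bool) : Subsingleton (S.H N c) := by
  have e : (Module.length R (S.H N false)).toNat = (Module.length R (S.H N true)).toNat := by
    have := sub_eq_zero.1 h0
    exact_mod_cast this
  have hz : (Module.length R (S.H N b)).toNat = 0 := by
    rw [Module.length_eq_zero]; rfl
  have hc : (Module.length R (S.H N c)).toNat = 0 := by
    cases b <;> cases c <;> simp_all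
  rw [← Module.length_eq_zero_iff (R := R)]
  rcases (ENat.toNat_eq_zero).1 hc with h | h
  · exact h
  · exact absurd h (Per.len_ne_top r hloc N c)

end TorRig

theorem tor_rigidity_of_class_zero
    (R : Type) [CommRing R] [IsNoetherianRing R] [IsLocalRing R]
    (M : Type) [AddCommGroup M] [Module R M] [Module.Finite R M]
    (hper : IsPeriodicSyzygy R M 2) (hloc : LocFreePunctured R M)
    (N : Type) [AddCommGroup N] [Module R N] [Module.Finite R N] (hN : ClassZeroQ R N)
    (n : ℕ) (hn : 1 ≤ n) (hvan : Subsingleton (TorM R n M N)) :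
    Subsingleton (TorM R (n + 1) M N) ∧
    ∀ i : ℕ, n ≤ i → Subsingleton (TorM R i M N) := by
  obtain ⟨S, ⟨r⟩⟩ := TorRig.exists_res M hper
  obtain ⟨k, f, hf⟩ := Module.Finite.exists_fin' R N
  let x : FGIdx R := ⟨k, LinearMap.ker f⟩
  let e : idxMod R x ≃ₗ[R] N := f.quotKerEquivOfSurjective hf
  have hchi := TorRig.Per.chi_zero r hloc x (hN x ⟨e⟩)
  have htor : ∀ i, Subsingleton (TorM R i M N) ↔ Subsingleton (TorM R i M (idxMod R x)) := by
    intro i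
    exact (((Tor (ModuleCat R) i).obj (ModuleCat.of R M)).mapIso
      e.symm.toModuleIso).toLinearEquiv.toEquiv.subsingleton_congr
  have main : ∀ i : ℕ, 1 ≤ i → Subsingleton (TorM R i M N) := by
    intro i hi
    obtain ⟨i, rfl⟩ := Nat.exists_eq_add_of_le' hi
    obtain ⟨n, rfl⟩ := Nat.exists_eq_add_of_le' hn
    rw [htor, r.tor_iff] at hvan ⊢
    exact TorRig.Per.all_of_one r hloc _ hchi _ hvan _
  exact ⟨main _ (by omega), fun i hi => main i (by omega)⟩
end

section
/- Let R be a one-dimensional commutative Noetherian local domain and M a finitely generated R-module with M ≅ Ω^q M for some even integer q ≥ 2. Then M is (q−1)-Tor-rigid; in particular, if M ≅ Ω²M then M is Tor-rigid. -/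
open CategoryTheory IsLocalRing

open TensorProduct
/-- square lemma -/
lemma tq_square {R A F B G : Type} [CommRing R] [AddCommGroup A] [AddCommGroup F] [AddCommGroup B]
    [AddCommGroup G] [Module R A] [Module R F] [Module R B] [Module R G]
    [Module.Flat R F] [Module.Flat R G] (i : A →ₗ[R] F) (k : B →ₗ[R] G)
    (hi : Function.Injective i) (hk : Function.Injective k) :
    Function.Injective (i.rTensor B) ↔ Function.Injective (k.lTensor A) := by
  have h1 := Module.Flat.lTensor_preserves_injective_linearMap (M := F) k hk
  have h2 := Module.Flat.rTensor_preserves_injective_linearMap (M := G) i hi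
  have e : (k.lTensor F) ∘ₗ (i.rTensor B) = (i.rTensor G) ∘ₗ (k.lTensor A) := by
    rw [LinearMap.lTensor_comp_rTensor, LinearMap.rTensor_comp_lTensor]
  have e' : ⇑(k.lTensor F) ∘ ⇑(i.rTensor B) = ⇑(i.rTensor G) ∘ ⇑(k.lTensor A) := by
    rw [← LinearMap.coe_comp, e, LinearMap.coe_comp]
  rw [← h1.of_comp_iff, e', h2.of_comp_iff]

/-- one half of the snake -/
lemma tq_snake1 {R A F X B G N : Type} [CommRing R] [AddCommGroup A] [AddCommGroup F]
    [AddCommGroup B] [AddCommGroup G] [AddCommGroup X] [AddCommGroup N]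
    [Module R A] [Module R F] [Module R B] [Module R G] [Module R X] [Module R N]
    [Module.Flat R F] (i : A →ₗ[R] F) (p : F →ₗ[R] X) (k : B →ₗ[R] G) (s : G →ₗ[R] N)
    (hk : Function.Injective k)
    (hp : Function.Surjective p) (hs : Function.Surjective s)
    (hip : Function.Exact i p) (hks : Function.Exact k s)
    (h : Function.Injective (i.rTensor N)) : Function.Injective (k.lTensor X) := by
  rw [injective_iff_map_eq_zero]
  intro x hx
  obtain ⟨y, rfl⟩ := LinearMap.rTensor_surjective B hp x
  have c1 : p.rTensor G (k.lTensor F y) = 0 := by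
    rw [← hx, ← LinearMap.comp_apply, ← LinearMap.comp_apply, LinearMap.lTensor_comp_rTensor,
      LinearMap.rTensor_comp_lTensor]
  obtain ⟨z, hz⟩ := (rTensor_exact G hip hp _).1 c1
  have c2 : i.rTensor N (s.lTensor A z) = 0 := by
    have : i.rTensor N (s.lTensor A z) = s.lTensor F (i.rTensor G z) := by
      rw [← LinearMap.comp_apply, ← LinearMap.comp_apply, LinearMap.lTensor_comp_rTensor,
        LinearMap.rTensor_comp_lTensor]
    rw [this, hz]
    exact (lTensor_exact F hks hs).apply_apply_eq_zero y
  have c3 := (injective_iff_map_eq_zero _).1 h _ c2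
  obtain ⟨w, hw⟩ := (lTensor_exact A hks hs _).1 c3
  have c4 : k.lTensor F (i.rTensor B w) = k.lTensor F y := by
    rw [← hz, ← hw, ← LinearMap.comp_apply, ← LinearMap.comp_apply, LinearMap.lTensor_comp_rTensor,
        LinearMap.rTensor_comp_lTensor]
  rw [← Module.Flat.lTensor_preserves_injective_linearMap (M := F) k hk c4]
  exact (rTensor_exact B hip hp).apply_apply_eq_zero w

lemma tq_snake {R A F X B G N : Type} [CommRing R] [AddCommGroup A] [AddCommGroup F]
    [AddCommGroup B] [AddCommGroup G] [AddCommGroup X] [AddCommGroup N]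
    [Module R A] [Module R F] [Module R B] [Module R G] [Module R X] [Module R N]
    [Module.Flat R F] [Module.Flat R G]
    (i : A →ₗ[R] F) (p : F →ₗ[R] X) (k : B →ₗ[R] G) (s : G →ₗ[R] N)
    (hi : Function.Injective i) (hk : Function.Injective k)
    (hp : Function.Surjective p) (hs : Function.Surjective s)
    (hip : Function.Exact i p) (hks : Function.Exact k s) :
    Function.Injective (i.rTensor N) ↔ Function.Injective (k.lTensor X) := by
  refine ⟨tq_snake1 i p k s hk hp hs hip hks, fun h => ?_⟩
  rw [← LinearMap.lTensor_inj_iff_rTensor_inj]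
  refine tq_snake1 k s i p hi hs hp hks hip ?_
  rwa [← LinearMap.lTensor_inj_iff_rTensor_inj]

/-- comparing `N` with a torsion quotient `T = N / free` -/
lemma tq_torsion_down {R A F X B N T : Type} [CommRing R] [AddCommGroup A] [AddCommGroup F]
    [AddCommGroup B] [AddCommGroup X] [AddCommGroup N] [AddCommGroup T]
    [Module R A] [Module R F] [Module R B] [Module R X] [Module R N] [Module R T]
    [Module.Flat R F] (i : A →ₗ[R] F) (p : F →ₗ[R] X) (k : B →ₗ[R] N) (s : N →ₗ[R] T)
    (hk : Function.Injective k)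
    (hp : Function.Surjective p) (hs : Function.Surjective s)
    (hip : Function.Exact i p) (hks : Function.Exact k s)
    (c : R) (hcT : ∀ t : T, c • t = 0) (hcX : ∀ u : X ⊗[R] B, c • u = 0 → u = 0)
    (h : Function.Injective (i.rTensor N)) : Function.Injective (i.rTensor T) := by
  rw [injective_iff_map_eq_zero]
  intro x hx
  obtain ⟨y, rfl⟩ := LinearMap.lTensor_surjective A hs x
  have sq : ∀ z, i.rTensor T (s.lTensor A z) = s.lTensor F (i.rTensor N z) := fun z => by
    rw [← LinearMap.comp_apply, ← LinearMap.comp_apply, LinearMap.lTensor_comp_rTensor,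
      LinearMap.rTensor_comp_lTensor]
  have sq' : ∀ z, i.rTensor N (k.lTensor A z) = k.lTensor F (i.rTensor B z) := fun z => by
    rw [← LinearMap.comp_apply, ← LinearMap.comp_apply, LinearMap.lTensor_comp_rTensor,
      LinearMap.rTensor_comp_lTensor]
  rw [sq] at hx
  obtain ⟨w, hw⟩ := (lTensor_exact F hks hs _).1 hx
  have hc : ∀ v : A ⊗[R] T, c • v = 0 := fun v => by
    induction v with
    | zero => simp
    | tmul a t => rw [← TensorProduct.tmul_smul, hcT, TensorProduct.tmul_zero]
    | add a b ha hb => rw [smul_add, ha, hb, add_zero]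
  have h1 : s.lTensor A (c • y) = 0 := by rw [map_smul, hc]
  obtain ⟨u, hu⟩ := (lTensor_exact A hks hs _).1 h1
  have inj := Module.Flat.lTensor_preserves_injective_linearMap (M := F) k hk
  have h2 : i.rTensor B u = c • w := inj (by rw [← sq', hu, map_smul, map_smul, hw])
  have h3 : p.rTensor B w = 0 := hcX _ (by
    rw [← map_smul, ← h2]; exact (rTensor_exact B hip hp).apply_apply_eq_zero u)
  obtain ⟨u', hu'⟩ := (rTensor_exact B hip hp _).1 h3
  have h4 : k.lTensor A u' = y := h (by rw [sq', hu', hw])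
  rw [← h4]
  exact (lTensor_exact A hks hs).apply_apply_eq_zero u'

lemma tq_torsion_up {R A F B N T : Type} [CommRing R] [AddCommGroup A] [AddCommGroup F]
    [AddCommGroup B] [AddCommGroup N] [AddCommGroup T]
    [Module R A] [Module R F] [Module R B] [Module R N] [Module R T]
    [Module.Flat R F] [Module.Flat R B] (i : A →ₗ[R] F) (k : B →ₗ[R] N) (s : N →ₗ[R] T)
    (hi : Function.Injective i) (hk : Function.Injective k)
    (hs : Function.Surjective s) (hks : Function.Exact k s)
    (h : Function.Injective (i.rTensor T)) : Function.Injective (i.rTensor N) := by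
  rw [injective_iff_map_eq_zero]
  intro y hy
  have sq : ∀ z, i.rTensor T (s.lTensor A z) = s.lTensor F (i.rTensor N z) := fun z => by
    rw [← LinearMap.comp_apply, ← LinearMap.comp_apply, LinearMap.lTensor_comp_rTensor,
      LinearMap.rTensor_comp_lTensor]
  have sq' : ∀ z, i.rTensor N (k.lTensor A z) = k.lTensor F (i.rTensor B z) := fun z => by
    rw [← LinearMap.comp_apply, ← LinearMap.comp_apply, LinearMap.lTensor_comp_rTensor,
      LinearMap.rTensor_comp_lTensor]
  have h1 : s.lTensor A y = 0 := h (by rw [sq, hy, map_zero, map_zero])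
  obtain ⟨u, rfl⟩ := (lTensor_exact A hks hs _).1 h1
  rw [sq'] at hy
  have h2 := (injective_iff_map_eq_zero _).1
    (Module.Flat.lTensor_preserves_injective_linearMap (M := F) k hk) _ hy
  have h3 := (injective_iff_map_eq_zero _).1
    (Module.Flat.rTensor_preserves_injective_linearMap (M := B) i hi) _ h2
  rw [h3, map_zero]

/-- existence of free submodule with torsion quotient -/
lemma tq_exists_free {R N : Type} [CommRing R] [IsNoetherianRing R] [IsDomain R]
    [AddCommGroup N] [Module R N] [Module.Finite R N] :
    ∃ (s : ℕ) (k : (Fin s → R) →ₗ[R] N), Function.Injective k ∧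
      ∃ c : R, c ≠ 0 ∧ ∀ t : N ⧸ LinearMap.range k, c • t = 0 := by
  obtain ⟨b, hb⟩ := exists_linearIndependent_of_le_finrank (R := R) (M := N) le_rfl
  refine ⟨_, Fintype.linearCombination R b, hb.fintypeLinearCombination_injective, ?_⟩
  set k := Fintype.linearCombination R b
  have hr : Module.finrank R (LinearMap.range k) = Module.finrank R N := by
    rw [LinearMap.finrank_range_of_inj hb.fintypeLinearCombination_injective]; simp
  have := Submodule.finrank_quotient_add_finrank (LinearMap.range k)
  have h0 : Module.finrank R (N ⧸ LinearMap.range k) = 0 := by omega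
  have ht : Module.IsTorsion R (N ⧸ LinearMap.range k) := by
    rw [Module.finrank_eq_zero_iff_isTorsion] at h0; exact h0
  obtain ⟨c, hc⟩ := Submodule.annihilator_top_inter_nonZeroDivisors ht
  refine ⟨c, nonZeroDivisors.ne_zero hc.2, fun t => ?_⟩
  exact Submodule.mem_annihilator.1 hc.1 t trivial

lemma tq_length {R T : Type} [CommRing R] [IsNoetherianRing R] [IsDomain R]
    (hdim : ringKrullDim R = 1)
    [AddCommGroup T] [Module R T] [Module.Finite R T] (c : R) (hc : c ≠ 0)
    (hcT : ∀ t : T, c • t = 0) : Module.length R T ≠ ⊤ := by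
  have : Ring.KrullDimLE 1 R := by
    rw [Ring.krullDimLE_iff, hdim]; rfl
  have hfl := isFiniteLength_quotient_span_singleton R (mem_nonZeroDivisors_of_ne_zero hc)
  obtain ⟨n, g, hg⟩ := Module.Finite.exists_fin' R T
  rw [← Module.length_ne_top_iff] at hfl
  let I := Ideal.span {c}
  let f : (Fin n → R) →ₗ[R] (Fin n → R ⧸ I) := LinearMap.pi fun j => (I.mkQ).comp (LinearMap.proj j)
  have hf : Function.Surjective f := fun y => by
    choose z hz using fun j => I.mkQ_surjective (y j)
    exact ⟨z, funext hz⟩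
  have hker : LinearMap.ker f ≤ LinearMap.ker g := by
    intro v hv
    have : ∀ j, ∃ a, a * c = v j := fun j => by
      have := congrFun (LinearMap.mem_ker.1 hv) j
      have : v j ∈ I := Ideal.Quotient.eq_zero_iff_mem.1 (by simpa [f] using this)
      exact Ideal.mem_span_singleton'.1 this
    choose a ha using this
    have : v = c • a := by ext j; simp [← ha, mul_comm]
    rw [LinearMap.mem_ker, this, map_smul, hcT]
  have hs : Function.Surjective ((LinearMap.ker f).liftQ g hker ∘ₗ
      (f.quotKerEquivOfSurjective hf).symm.toLinearMap) := by
    rw [LinearMap.coe_comp]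
    refine Function.Surjective.comp ?_ (LinearEquiv.surjective _)
    intro t; obtain ⟨v, rfl⟩ := hg t; exact ⟨Submodule.Quotient.mk v, rfl⟩
  refine ne_top_of_le_ne_top ?_ (Module.length_le_of_surjective _ hs)
  rw [Module.length_pi]
  simp only [ENat.card_eq_coe_fintype_card]
  exact WithTop.mul_ne_top (by rw [Fintype.card_fin]; exact ENat.natCast_ne_top n) hfl

lemma tq_len_inj {R A B C : Type} [CommRing R] [AddCommGroup A] [AddCommGroup B] [AddCommGroup C]
    [Module R A] [Module R B] [Module R C] (f : A →ₗ[R] B) (g : B →ₗ[R] C)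
    (hg : Function.Surjective g) (hfg : Function.Exact f g)
    (hB : Module.length R B ≠ ⊤)
    (h : Module.length R A + Module.length R C = Module.length R B) : Function.Injective f := by
  have h1 := Module.length_eq_add_of_exact (LinearMap.ker f).subtype f.rangeRestrict
    (Submodule.injective_subtype _) f.surjective_rangeRestrict (by
      rw [LinearMap.exact_iff, LinearMap.ker_rangeRestrict, Submodule.range_subtype])
  have h2 := Module.length_eq_add_of_exact (LinearMap.range f).subtype g
    (Submodule.injective_subtype _) hg (by
      rw [LinearMap.exact_iff, Submodule.range_subtype]; exact hfg.linearMap_ker_eq)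
  rw [h1, add_assoc, ← h2] at h
  have h3 : Module.length R (LinearMap.ker f) = 0 := by
    generalize Module.length R (LinearMap.ker f) = x at h
    generalize Module.length R B = y at h hB
    lift y to ℕ using hB
    cases x with
    | top => simp at h
    | coe x => norm_cast at h ⊢; omega
  rw [Module.length_eq_zero_iff] at h3
  rw [← LinearMap.ker_eq_bot, Submodule.eq_bot_of_subsingleton (p := LinearMap.ker f)]

section
variable {R : Type} [CommRing R] {n : ℕ → ℕ}
    (d : ∀ i : ℕ, ((Fin (n (i + 1)) → R) →ₗ[R] (Fin (n i) → R)))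
    (hd : ∀ i, LinearMap.ker (d i) = LinearMap.range (d (i + 1)))

abbrev tqX (a : ℕ) : Type := (Fin (n a) → R) ⧸ LinearMap.range (d a)

def tqi (a : ℕ) : tqX d (a + 1) →ₗ[R] (Fin (n a) → R) :=
  (LinearMap.range (d (a + 1))).liftQ (d a) (hd a).ge

lemma tqi_inj (a : ℕ) : Function.Injective (tqi d hd a) := by
  rw [← LinearMap.ker_eq_bot]
  exact Submodule.ker_liftQ_eq_bot _ _ _ (hd a).le

lemma tqi_range (a : ℕ) : LinearMap.range (tqi d hd a) = LinearMap.range (d a) := by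
  exact Submodule.range_liftQ _ _ _

lemma tqi_exact (a : ℕ) : Function.Exact (tqi d hd a) (LinearMap.range (d a)).mkQ := by
  rw [LinearMap.exact_iff, tqi_range, Submodule.ker_mkQ]

lemma tqi_shift (a : ℕ) {B G N : Type} [AddCommGroup B] [AddCommGroup G] [AddCommGroup N]
    [Module R B] [Module R G] [Module R N] [Module.Flat R G] (k : B →ₗ[R] G) (s : G →ₗ[R] N)
    (hk : Function.Injective k) (hs : Function.Surjective s) (hks : Function.Exact k s) :
    Function.Injective ((tqi d hd (a + 1)).rTensor N) ↔
      Function.Injective ((tqi d hd a).rTensor B) := by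
  rw [tq_square (tqi d hd a) k (tqi_inj d hd a) hk]
  exact tq_snake _ _ k s (tqi_inj d hd (a+1)) hk (Submodule.mkQ_surjective _) hs
    (tqi_exact d hd (a+1)) hks

lemma tq_main [IsNoetherianRing R] [IsDomain R] (hdim : ringKrullDim R = 1)
    (q : ℕ) (hq2 : 2 ≤ q) (hqe : Even q) (e : tqX d 0 ≃ₗ[R] tqX d q)
    (N : Type) [AddCommGroup N] [Module R N] [Module.Finite R N]
    (h : ∀ a, a ≤ q - 2 → Function.Injective ((tqi d hd a).rTensor N)) :
    Function.Injective ((tqi d hd (q - 1)).rTensor N) := by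
  obtain ⟨s, k, hk, c, hc, hcT⟩ := tq_exists_free (R := R) (N := N)
  set T := N ⧸ LinearMap.range k
  have hs := (LinearMap.range k).mkQ_surjective
  have hks : Function.Exact k (LinearMap.range k).mkQ := by
    rw [LinearMap.exact_iff, Submodule.ker_mkQ]
  have hT := tq_length hdim c hc hcT
  obtain ⟨q, rfl⟩ : ∃ q', q = q' + 2 := ⟨q - 2, by omega⟩
  have tf1 : ∀ a, ∀ x : tqX d (a + 1), c • x = 0 → x = 0 := fun a x hx => by
    apply tqi_inj d hd a
    rw [map_zero]
    have : c • tqi d hd a x = 0 := by rw [← map_smul, hx, map_zero]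
    exact (smul_eq_zero.1 this).resolve_left hc
  have tf : ∀ a, ∀ x : tqX d a, c • x = 0 → x = 0 := fun a x hx => by
    cases a with
    | zero =>
      apply e.injective
      rw [map_zero]
      exact tf1 (q + 1) _ (by rw [← map_smul, hx, map_zero])
    | succ a => exact tf1 a x hx
  have hcX : ∀ a, ∀ u : tqX d a ⊗[R] (Fin s → R), c • u = 0 → u = 0 := fun a u hu => by
    apply (TensorProduct.piScalarRight R R (tqX d a) (Fin s)).injective
    rw [map_zero]
    ext1 j
    refine tf a _ ?_
    have := congrFun (congrArg (TensorProduct.piScalarRight R R (tqX d a) (Fin s)) hu) j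
    rwa [map_smul, map_zero] at this
  have hVT : ∀ a, a ≤ q → Function.Injective ((tqi d hd a).rTensor T) := fun a ha =>
    tq_torsion_down _ _ k _ hk (Submodule.mkQ_surjective _) hs (tqi_exact d hd a) hks c hcT
      (hcX a) (h a (by omega))
  refine tq_torsion_up _ k _ (tqi_inj d hd _) hk hs hks ?_
  have hF : ∀ a, Module.length R ((Fin (n a) → R) ⊗[R] T) = n a * Module.length R T := fun a => by
    rw [((TensorProduct.comm R _ _).trans (TensorProduct.piScalarRight R R T (Fin (n a)))).length_eq,
      Module.length_pi, ENat.card_eq_coe_fintype_card, Fintype.card_fin]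
  have hFt : ∀ a, Module.length R ((Fin (n a) → R) ⊗[R] T) ≠ ⊤ := fun a => by
    rw [hF]; exact WithTop.mul_ne_top (ENat.natCast_ne_top _) hT
  have hps : ∀ a, Function.Surjective ((LinearMap.range (d a)).mkQ.rTensor T) := fun a =>
    LinearMap.rTensor_surjective T (Submodule.mkQ_surjective _)
  have hex : ∀ a, Function.Exact ((tqi d hd a).rTensor T) ((LinearMap.range (d a)).mkQ.rTensor T) :=
    fun a => rTensor_exact T (tqi_exact d hd a) (Submodule.mkQ_surjective _)
  have hXt : ∀ a, Module.length R (tqX d a ⊗[R] T) ≠ ⊤ := fun a =>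
    ne_top_of_le_ne_top (hFt a) (Module.length_le_of_surjective _ (hps a))
  obtain ⟨t, ht⟩ := ENat.ne_top_iff_exists.1 hT
  choose l hl using fun a => ENat.ne_top_iff_exists.1 (hXt a)
  have hadd : ∀ a, a ≤ q → l (a + 1) + l a = n a * t := fun a ha => by
    have := Module.length_eq_add_of_exact _ _ (hVT a ha) (hps a) (hex a)
    rw [hF, ← hl, ← hl, ← ht] at this
    exact_mod_cast this.symm
  have hrk : ∀ a, Module.finrank R (tqX d (a + 1)) + Module.finrank R (tqX d a) = n a := fun a => by
    have := Submodule.finrank_quotient_add_finrank (LinearMap.range (d a))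
    rw [Module.finrank_fin_fun] at this
    rw [add_comm, (LinearEquiv.ofInjective _ (tqi_inj d hd a)).finrank_eq, tqi_range]
    exact this
  have hl0 : l 0 = l (q + 2) := by
    have := (TensorProduct.congr e (LinearEquiv.refl R T)).length_eq
    rw [← hl, ← hl] at this
    exact_mod_cast this
  have hr0 := e.finrank_eq
  generalize hρ : (fun a => Module.finrank R (tqX d a)) = ρ at *
  have hρ' : ∀ a, Module.finrank R (tqX d a) = ρ a := fun a => by rw [← hρ]
  simp only [hρ'] at hrk hr0
  have key : ∀ a, a ≤ q + 1 → (l a : ℤ) - t * ρ a = (-1) ^ a * (l 0 - t * ρ 0) := by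
    intro a ha
    induction a with
    | zero => simp
    | succ a ih =>
      have h1 := ih (by omega)
      have h2 := hadd a (by omega)
      rw [← hrk a] at h2
      zify at h2
      rw [pow_succ]
      linarith
  have k1 := key (q + 1) le_rfl
  have hodd : Odd (q + 1) := by
    obtain ⟨m, hm⟩ := hqe; exact ⟨m - 1, by omega⟩
  rw [hodd.neg_one_pow, hl0, hr0] at k1
  refine tq_len_inj _ _ (hps (q + 1)) (hex (q + 1)) (hFt _) ?_
  rw [hF]
  change Module.length R (tqX d (q + 2) ⊗[R] T) + Module.length R (tqX d (q + 1) ⊗[R] T) =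
    n (q + 1) * _
  rw [← hl, ← hl, ← ht]
  have k2 : l (q + 2) + l (q + 1) = n (q + 1) * t := by
    rw [← hrk]; zify; linarith
  exact_mod_cast k2

lemma tq_main' [IsNoetherianRing R] [IsDomain R] (hdim : ringKrullDim R = 1)
    (q : ℕ) (hq2 : 2 ≤ q) (hqe : Even q) (e : tqX d 0 ≃ₗ[R] tqX d q) (r : ℕ) :
    ∀ (N : Type) [AddCommGroup N] [Module R N] [Module.Finite R N],
    (∀ a, r ≤ a → a ≤ r + q - 2 → Function.Injective ((tqi d hd a).rTensor N)) →
    Function.Injective ((tqi d hd (r + q - 1)).rTensor N) := by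
  induction r with
  | zero =>
    intro N _ _ _ h
    rw [zero_add]
    exact tq_main d hd hdim q hq2 hqe e N fun a ha => h a (by omega) (by omega)
  | succ r ih =>
    intro N _ _ _ h
    obtain ⟨m, g, hg⟩ := Module.Finite.exists_fin' R N
    have hex : Function.Exact (LinearMap.ker g).subtype g := by
      rw [LinearMap.exact_iff, Submodule.range_subtype]
    have sh := fun a => tqi_shift d hd a (LinearMap.ker g).subtype g
      (Submodule.injective_subtype _) hg hex
    rw [show r + 1 + q - 1 = (r + q - 1) + 1 by omega, sh]
    exact ih _ fun a h1 h2 => (sh a).1 (h (a + 1) (by omega) (by omega))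

end

lemma tq_iso {R A F N N' : Type} [CommRing R] [AddCommGroup A] [AddCommGroup F]
    [AddCommGroup N] [AddCommGroup N'] [Module R A] [Module R F] [Module R N] [Module R N']
    (i : A →ₗ[R] F) (e : N ≃ₗ[R] N') (h : Function.Injective (i.rTensor N)) :
    Function.Injective (i.rTensor N') := by
  have sq : i.rTensor N' = ((e.lTensor F).toLinearMap ∘ₗ (i.rTensor N)) ∘ₗ
      (e.symm.lTensor A).toLinearMap := by
    ext a t
    simp
  rw [sq, LinearMap.coe_comp, LinearMap.coe_comp]
  exact ((e.lTensor F).injective.comp h).comp (e.symm.lTensor A).injective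

section
variable {R : Type} [CommRing R] {n : ℕ → ℕ}
    (d : ∀ i : ℕ, ((Fin (n (i + 1)) → R) →ₗ[R] (Fin (n i) → R)))
    (hd : ∀ i, LinearMap.ker (d i) = LinearMap.range (d (i + 1)))

lemma tq_link {M N : Type} [AddCommGroup M] [Module R M] [AddCommGroup N] [Module R N]
    (g : (Fin (n 0) → R) →ₗ[R] M) (hg : Function.Surjective g)
    (hgd : LinearMap.ker g = LinearMap.range (d 0))
    (E : ℕ → Type) [∀ j, AddCommGroup (E j)] [∀ j, Module R (E j)] [∀ j, Module.Flat R (E j)]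
    (δ : ∀ j, E (j + 1) →ₗ[R] E j) (hδ : ∀ j, Function.Exact (δ (j + 1)) (δ j))
    (ε : E 0 →ₗ[R] N) (hε : Function.Surjective ε) (hεδ : Function.Exact (δ 0) ε) (j : ℕ) :
    Function.Exact ((δ (j + 1)).lTensor M) ((δ j).lTensor M) ↔
      Function.Injective ((tqi d hd j).rTensor N) := by
  let Y : ℕ → Type := fun j => E j ⧸ LinearMap.range (δ j)
  let κ : ∀ j, (E (j + 1) ⧸ LinearMap.range (δ (j + 1))) →ₗ[R] E j := fun j =>
    (LinearMap.range (δ (j + 1))).liftQ (δ j) (hδ j).linearMap_ker_eq.ge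
  have κinj : ∀ j, Function.Injective (κ j) := fun j => by
    rw [← LinearMap.ker_eq_bot]
    exact Submodule.ker_liftQ_eq_bot _ _ _ (hδ j).linearMap_ker_eq.le
  have κex : ∀ j, Function.Exact (κ j) (LinearMap.range (δ j)).mkQ := fun j => by
    rw [LinearMap.exact_iff, Submodule.ker_mkQ]
    exact (Submodule.range_liftQ _ _ _).symm
  have hκδ : δ j = κ j ∘ₗ (LinearMap.range (δ (j + 1))).mkQ := rfl
  have ex1 : Function.Exact (δ (j + 1)) (LinearMap.range (δ (j + 1))).mkQ := by
    rw [LinearMap.exact_iff, Submodule.ker_mkQ]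
  have ex2 := lTensor_exact M ex1 (Submodule.mkQ_surjective _)
  have sj := LinearMap.lTensor_surjective M (LinearMap.range (δ (j + 1))).mkQ_surjective
  have step1 : Function.Exact ((δ (j + 1)).lTensor M) ((δ j).lTensor M) ↔
      Function.Injective ((κ j).lTensor M) := by
    rw [hκδ, LinearMap.lTensor_comp]
    constructor
    · intro h
      rw [injective_iff_map_eq_zero]
      intro x hx
      obtain ⟨y, rfl⟩ := sj x
      exact (ex2 y).2 ((h y).1 hx)
    · intro h y
      rw [← ex2 y, LinearMap.comp_apply]
      exact (map_eq_zero_iff _ h)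
  have hgd' : Function.Exact (tqi d hd 0) g := by
    rw [LinearMap.exact_iff, tqi_range, hgd]
  rw [step1, ← tq_snake (tqi d hd 0) g (κ j) (LinearMap.range (δ j)).mkQ (tqi_inj d hd 0) (κinj j)
    hg (Submodule.mkQ_surjective _) hgd' (κex j)]
  have step2 : ∀ a b, Function.Injective ((tqi d hd 0).rTensor
      (E (b + a) ⧸ LinearMap.range (δ (b + a)))) ↔
      Function.Injective ((tqi d hd a).rTensor (E b ⧸ LinearMap.range (δ b))) := by
    intro a
    induction a with
    | zero => intro b; rfl
    | succ a ih =>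
      intro b
      rw [tqi_shift d hd a (κ b) (LinearMap.range (δ b)).mkQ (κinj b) (Submodule.mkQ_surjective _)
        (κex b), ← ih (b + 1), show b + (a + 1) = b + 1 + a by omega]
  have := step2 j 0
  rw [Nat.zero_add j] at this
  rw [this]
  let e : (E 0 ⧸ LinearMap.range (δ 0)) ≃ₗ[R] N :=
    (Submodule.quotEquivOfEq _ _ hεδ.linearMap_ker_eq.symm).trans
      (ε.quotKerEquivOfSurjective hε)
  exact ⟨tq_iso _ e, tq_iso _ e.symm⟩

open CategoryTheory in
/-- Vanishing of Tor through a projective resolution of the second argument. -/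
lemma tq_tor_iff (M N : Type) [AddCommGroup M] [Module R M]
    [AddCommGroup N] [Module R N] (P : ProjectiveResolution (ModuleCat.of R N)) (j : ℕ) :
    Subsingleton (TorM R (j + 1) M N) ↔
      Function.Exact ((P.complex.d (j + 1 + 1) (j + 1)).hom.lTensor M)
        ((P.complex.d (j + 1) j).hom.lTensor M) := by
  let F := (MonoidalCategory.tensoringLeft (ModuleCat R)).obj (ModuleCat.of R M)
  have e := P.isoLeftDerivedObj F (j + 1)
  have h1 : Subsingleton (TorM R (j + 1) M N) ↔
      ((F.mapHomologicalComplex (ComplexShape.down ℕ)).obj P.complex).ExactAt (j + 1) := by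
    rw [HomologicalComplex.exactAt_iff_isZero_homology, ← ModuleCat.isZero_iff_subsingleton]
    exact e.isZero_iff
  rw [h1, HomologicalComplex.exactAt_iff' _ (j + 1 + 1) (j + 1) j (by simp) (by simp),
    ShortComplex.ShortExact.moduleCat_exact_iff_function_exact]
  rfl

open CategoryTheory in
lemma tq_tor {M N : Type} [AddCommGroup M] [Module R M] [AddCommGroup N] [Module R N]
    (g : (Fin (n 0) → R) →ₗ[R] M) (hg : Function.Surjective g)
    (hgd : LinearMap.ker g = LinearMap.range (d 0)) (j : ℕ) :
    Subsingleton (TorM R (j + 1) M N) ↔ Function.Injective ((tqi d hd j).rTensor N) := by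
  let P : ProjectiveResolution (ModuleCat.of R N) := projectiveResolution _
  rw [tq_tor_iff M N P]
  have : ∀ j, Module.Flat R (P.complex.X j) := fun j => by
    have : Module.Projective R (P.complex.X j) := by
      have := P.projective j
      exact (IsProjective.iff_projective (R := R) (P.complex.X j)).2 this
    infer_instance
  refine tq_link d hd g hg hgd (fun j => P.complex.X j) (fun j => (P.complex.d (j + 1) j).hom)
    (fun j => ?_) (N := N) (P.π.f 0).hom ?_ ?_ j
  · exact (ShortComplex.ShortExact.moduleCat_exact_iff_function_exact _).1 (P.exact_succ j)
  · exact (ModuleCat.epi_iff_surjective (P.π.f 0)).1 inferInstance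
  · exact (ShortComplex.ShortExact.moduleCat_exact_iff_function_exact _).1 P.exact₀

end

theorem q_minus_one_tor_rigid_over_one_dim_domain
    (R : Type) [CommRing R] [IsNoetherianRing R] [IsLocalRing R] [IsDomain R]
    (hdim : ringKrullDim R = 1)
    (M : Type) [AddCommGroup M] [Module R M] [Module.Finite R M]
    (q : ℕ) (hq2 : 2 ≤ q) (hqe : Even q) (hper : IsPeriodicSyzygy R M q) :
    ∀ (N : Type) [AddCommGroup N] [Module R N] [Module.Finite R N],
      ∀ r : ℕ, 1 ≤ r →
        (∀ i : ℕ, r ≤ i → i ≤ r + q - 2 → Subsingleton (TorM R i M N)) →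
        ∀ j : ℕ, r ≤ j → Subsingleton (TorM R j M N) := by
  obtain ⟨n, d, g, hg, hgd, hd, -, -, ⟨f⟩⟩ := hper
  intro N _ _ _ r hr h
  obtain ⟨q', rfl⟩ : ∃ q', q = q' + 1 := ⟨q - 1, by omega⟩
  let e : tqX d 0 ≃ₗ[R] tqX d (q' + 1) :=
    (Submodule.quotEquivOfEq _ _ hgd.symm).trans ((g.quotKerEquivOfSurjective hg).trans
      (f.trans ((LinearEquiv.ofEq _ _ (tqi_range d hd q')).symm.trans
        (LinearEquiv.ofInjective _ (tqi_inj d hd q')).symm)))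
  intro j
  induction j using Nat.strong_induction_on with
  | _ j ih =>
    intro hj
    by_cases hj2 : j ≤ r + (q' + 1) - 2
    · exact h j hj hj2
    · obtain ⟨s, rfl⟩ : ∃ s, j = s + (q' + 1) - 1 + 1 := ⟨j - (q' + 1), by omega⟩
      rw [tq_tor d hd g hg hgd]
      refine tq_main' d hd hdim (q' + 1) hq2 hqe e s N fun a h1 h2 => ?_
      rw [← tq_tor d hd g hg hgd]
      exact ih (a + 1) (by omega) (by omega)
end
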